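/- arXiv:2506.08465 — 3 statements merged into one kernel-verified Lean document; each statement's English description precedes it below -/
import Mathlib

section
/- Let T > 0 and let c ≥ 1 + √(1 + 2T). There exist a number λ₀ ≥ 1 and a constant C₁ > 0 (both depending only on c and T) such that for every λ ≥ λ₀ and every function u : [0,1] × [0,T] → ℝ of class C² satisfying the Neumann boundary conditions ∂ₓu(0,t) = ∂ₓu(1,t) = 0 for all t ∈ [0,T], the following Carleman estimate holds: ∫₀ᵀ∫₀¹ (∂ₜu + ∂ₓₓu)² φ_λ² dx dt ≥ C₁ √λ ∫₀ᵀ∫₀¹ (∂ₓu)² φ_λ² dx dt + C₁ λ² c^λ ∫₀ᵀ∫₀¹ u² φ_λ² dx dt − C₁ e^{2c^λ} ∫₀¹ ((∂ₓu)²(x,T) + u²(x,T)) dx − C₁ λ (T+c)^λ e^{2(T+c)^λ} ∫₀¹ u²(x,0) dx. -/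
open MeasureTheory intervalIntegral

/-- The Carleman Weight Function `φ_λ(t) = exp((T − t + c)^λ)`. -/
noncomputable def carlemanWeight (T c lam t : ℝ) : ℝ := Real.exp ((T - t + c) ^ lam)


lemma extract_derivs (u : ℝ → ℝ → ℝ) (hu : ContDiff ℝ 2 (fun p : ℝ × ℝ => u p.1 p.2)) :
    ∃ ux ut uxx uxt : ℝ → ℝ → ℝ,
      Continuous (fun p : ℝ × ℝ => ux p.1 p.2) ∧ Continuous (fun p : ℝ × ℝ => ut p.1 p.2) ∧
      Continuous (fun p : ℝ × ℝ => uxx p.1 p.2) ∧ Continuous (fun p : ℝ × ℝ => uxt p.1 p.2) ∧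
      (∀ x t, HasDerivAt (fun y => u y t) (ux x t) x) ∧
      (∀ x t, HasDerivAt (fun s => u x s) (ut x t) t) ∧
      (∀ x t, HasDerivAt (fun y => ux y t) (uxx x t) x) ∧
      (∀ x t, HasDerivAt (fun s => ux x s) (uxt x t) t) ∧
      (∀ x t, HasDerivAt (fun y => ut y t) (uxt x t) x) := by
  set F : ℝ × ℝ → ℝ := fun p => u p.1 p.2 with hF
  have hF1 : ContDiff ℝ 1 (fderiv ℝ F) := hu.fderiv_right (by norm_num)
  have hF2 : Continuous (fderiv ℝ (fderiv ℝ F)) := hF1.continuous_fderiv (by norm_num)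
  have hd : ∀ p, HasFDerivAt F (fderiv ℝ F p) p := fun p =>
    (hu.differentiable (by norm_num) p).hasFDerivAt
  have hd2 : ∀ p, HasFDerivAt (fderiv ℝ F) (fderiv ℝ (fderiv ℝ F) p) p := fun p =>
    (hF1.differentiable (by norm_num) p).hasFDerivAt
  have hx : ∀ x t : ℝ, HasDerivAt (fun y : ℝ => (y, t)) ((1 : ℝ), (0 : ℝ)) x := fun x t =>
    (hasDerivAt_id x).prodMk (hasDerivAt_const x t)
  have ht : ∀ x t : ℝ, HasDerivAt (fun s : ℝ => (x, s)) ((0 : ℝ), (1 : ℝ)) t := fun x t =>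
    (hasDerivAt_const t x).prodMk (hasDerivAt_id t)
  have hsymm : ∀ p, fderiv ℝ (fderiv ℝ F) p (1, 0) (0, 1) = fderiv ℝ (fderiv ℝ F) p (0, 1) (1, 0) := by
    intro p
    exact (hu.contDiffAt.isSymmSndFDerivAt (by simp)) _ _
  have hv : ∀ p v, HasFDerivAt (fun p => fderiv ℝ F p v) ((fderiv ℝ (fderiv ℝ F) p).flip v) p := by
    intro p v
    have := (hd2 p).clm_apply (hasFDerivAt_const v p)
    simpa using this
  refine ⟨fun x t => fderiv ℝ F (x, t) (1, 0), fun x t => fderiv ℝ F (x, t) (0, 1),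
    fun x t => fderiv ℝ (fderiv ℝ F) (x, t) (1, 0) (1, 0),
    fun x t => fderiv ℝ (fderiv ℝ F) (x, t) (0, 1) (1, 0), ?_, ?_, ?_, ?_, ?_, ?_, ?_, ?_, ?_⟩
  · exact hF1.continuous.clm_apply continuous_const
  · exact hF1.continuous.clm_apply continuous_const
  · exact (hF2.clm_apply continuous_const).clm_apply continuous_const
  · exact (hF2.clm_apply continuous_const).clm_apply continuous_const
  · intro x t; exact (hd (x, t)).comp_hasDerivAt x (hx x t)
  · intro x t; exact (hd (x, t)).comp_hasDerivAt t (ht x t)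
  · intro x t; exact (hv (x, t) (1, 0)).comp_hasDerivAt x (hx x t)
  · intro x t; exact (hv (x, t) (1, 0)).comp_hasDerivAt t (ht x t)
  · intro x t
    show HasDerivAt _ (fderiv ℝ (fderiv ℝ F) (x, t) (0, 1) (1, 0)) x
    rw [← hsymm]
    exact (hv (x, t) (0, 1)).comp_hasDerivAt x (hx x t)

lemma cont_inner (f : ℝ → ℝ → ℝ) (hf : Continuous (fun p : ℝ × ℝ => f p.1 p.2)) :
    Continuous (fun t => ∫ x in (0 : ℝ)..1, f x t) := by
  apply intervalIntegral.continuous_parametric_intervalIntegral_of_continuous'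
  exact hf.comp continuous_swap

lemma int_t (T : ℝ) (G G' : ℝ → ℝ → ℝ) (hG' : Continuous (fun p : ℝ × ℝ => G' p.1 p.2))
    (hd : ∀ x t, HasDerivAt (fun s => G x s) (G' x t) t) :
    ∫ t in (0 : ℝ)..T, ∫ x in (0 : ℝ)..1, G' x t = ∫ x in (0 : ℝ)..1, (G x T - G x 0) := by
  rw [intervalIntegral_intervalIntegral_swap (F := fun t x => G' x t)]
  · apply intervalIntegral.integral_congr
    intro x _
    show ∫ t in (0 : ℝ)..T, G' x t = _
    apply integral_eq_sub_of_hasDerivAt (fun t _ => hd x t)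
    exact (hG'.comp (by fun_prop : Continuous (fun t : ℝ => (x, t)))).intervalIntegrable _ _
  · have hc : Continuous (Function.uncurry fun t x => G' x t) := hG'.comp continuous_swap
    exact (hc.continuousOn.integrableOn_compact (isCompact_uIcc.prod isCompact_uIcc)).mono_set
      (Set.prod_mono Set.uIoc_subset_uIcc Set.uIoc_subset_uIcc)

lemma int_x (T : ℝ) (H H' : ℝ → ℝ → ℝ) (hH' : Continuous (fun p : ℝ × ℝ => H' p.1 p.2))
    (hd : ∀ x t, HasDerivAt (fun y => H y t) (H' x t) x)
    (h0 : ∀ t ∈ Set.uIcc 0 T, H 0 t = 0 ∧ H 1 t = 0) :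
    ∫ t in (0 : ℝ)..T, ∫ x in (0 : ℝ)..1, H' x t = 0 := by
  rw [intervalIntegral.integral_congr (g := fun _ => (0 : ℝ))]
  · simp
  intro t ht
  show ∫ x in (0 : ℝ)..1, H' x t = 0
  rw [integral_eq_sub_of_hasDerivAt (f := fun y => H y t) (fun x _ => hd x t)]
  · rw [(h0 t ht).1, (h0 t ht).2, sub_zero]
  · exact (hH'.comp (by fun_prop : Continuous (fun x : ℝ => (x, t)))).intervalIntegrable _ _

lemma pointwise_ineq (u ux ut uxx uxt E q q1 n n1 k k1 C g a : ℝ) (hE : 0 ≤ E) (hC : 0 ≤ C)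
    (hg : k + n1 = g) (hn : 0 ≤ n) (hCn : C * n ≤ 1)
    (hD : a ≤ -n * q1 - g * q + k1 / 2 - C * k ^ 2 / 2) :
    C * g * (ux ^ 2 * E) + C * a * (u ^ 2 * E) ≤
      C * ((k1 / 2 * u ^ 2 + k * u * ut + n1 * ux ^ 2 + n * (2 * ux * uxt)
          - (n1 * q + n * q1) * u ^ 2 - n * q * (2 * u * ut)) * E
          + (k / 2 * u ^ 2 + n * ux ^ 2 - n * q * u ^ 2) * (-2 * q * E))
      + C * ((k * (ux * ux + u * uxx) - 2 * n * ((uxt - q * ux) * ux + (ut - q * u) * uxx)) * E)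
      + (ut + uxx) ^ 2 * E := by
  subst hg
  have key : C * (k + n1) * ux ^ 2 + C * a * u ^ 2 ≤
      C * (k1 / 2 * u ^ 2 + k * u * ut + n1 * ux ^ 2 + n * (2 * ux * uxt)
          - (n1 * q + n * q1) * u ^ 2 - n * q * (2 * u * ut)
          + (k / 2 * u ^ 2 + n * ux ^ 2 - n * q * u ^ 2) * (-2 * q)
      + (k * (ux * ux + u * uxx) - 2 * n * ((uxt - q * ux) * ux + (ut - q * u) * uxx)))
      + (ut + uxx) ^ 2 := by
    have h1 := mul_le_mul_of_nonneg_left (mul_le_mul_of_nonneg_right hD (sq_nonneg u)) hC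
    have h2 : 0 ≤ C * n * (ut - q * u - (uxx + q * u)) ^ 2 := by positivity
    have h3 : 0 ≤ (1 - C * n) * (ut + uxx) ^ 2 := mul_nonneg (by linarith) (sq_nonneg _)
    have h4 : 0 ≤ (ut + uxx + C * k * u) ^ 2 := sq_nonneg _
    nlinarith
  nlinarith [mul_le_mul_of_nonneg_right key hE]

set_option maxHeartbeats 2000000 in
/-- all parameter inequalities -/
lemma coeff_ineq (T c lam s t N C e sg P n : ℝ) (hT : 0 < T) (hc : 2 ≤ c) (hs : s = T - t + c)
    (ht0 : 0 ≤ t) (htT : t ≤ T) (hN : N = 10 * c ^ 2) (hC0 : 0 < C) (hC : C * N ≤ 1 / 4) (hC1 : C ≤ 1)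
    (hl : 14 ≤ lam) (hl1 : N / T ≤ Real.sqrt lam) (hl2 : 4 * (T + c) ≤ Real.sqrt lam)
    (hl3 : 10 * (T + c) ^ 2 * c ^ lam ≤ (c + T / 2) ^ lam) (hl4 : 4 * N / T ≤ lam)
    (hP : P ^ 2 = c ^ lam) (hP1 : 1 ≤ P) (hsg : sg = lam * P)
    (he : e = Real.exp (-(sg * (T - t)))) (hn : n = 1 + N * (t / T - e)) :
    0 ≤ n ∧ lam ^ 2 * c ^ lam ≤ -n * (-(lam * ((lam - 1) * s ^ (lam - 2))))
        - Real.sqrt lam * (lam * s ^ (lam - 1)) + (N * sg ^ 2 * e) / 2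
        - C * (Real.sqrt lam - N / T + N * sg * e) ^ 2 / 2 := by
  have hs0 : c ≤ s := by linarith
  have hspos : 0 < s := by linarith
  have hcpos : 0 < c := by linarith
  have hNpos : 0 < N := by rw [hN]; positivity
  have hsgl : lam ≤ sg := by rw [hsg]; nlinarith
  have hsgpos : 0 < sg := by linarith
  have hepos : 0 < e := by rw [he]; exact Real.exp_pos _
  have hX0 : 0 ≤ sg * (T - t) := mul_nonneg hsgpos.le (by linarith)
  have he1 : e ≤ 1 := by rw [he]; exact Real.exp_le_one_iff.mpr (by linarith)
  have heb : e * (1 + sg * (T - t)) ≤ 1 := by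
    have h := Real.add_one_le_exp (sg * (T - t))
    have h2 : e * Real.exp (sg * (T - t)) = 1 := by
      rw [he, ← Real.exp_add]; simp
    nlinarith
  have hn34 : 3 / 4 ≤ n := by
    -- N * (t/T - e) ≥ -1/4
    have hTs : 4 * N ≤ T * sg := by
      have : 4 * N ≤ lam * T := by rwa [div_le_iff₀ hT] at hl4
      nlinarith
    obtain ⟨y, hy⟩ : ∃ y, y = (T - t) / T := ⟨_, rfl⟩
    have hy0 : 0 ≤ y := by rw [hy]; apply div_nonneg <;> linarith
    have hy1 : y ≤ 1 := by rw [hy, div_le_one hT]; linarith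
    have hty : t / T = 1 - y := by rw [hy]; field_simp; ring
    have hTy : T - t = T * y := by rw [hy]; field_simp
    rw [hTy] at heb
    obtain ⟨K, hK⟩ : ∃ K, K = T * sg := ⟨_, rfl⟩
    have heb' : e * (1 + K * y) ≤ 1 := by rw [hK]; linarith
    rw [← hK] at hTs
    rw [hn, hty]
    have hKy : 0 < 1 + K * y := by nlinarith [mul_nonneg (by linarith : 0 ≤ K) hy0]
    have h5 : N * e ≤ N * (1 - y) + 1 / 4 := by
      have h6 : N * e * (1 + K * y) ≤ (N * (1 - y) + 1 / 4) * (1 + K * y) := by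
        have h7 : N ≤ (N * (1 - y) + 1 / 4) * (1 + K * y) := by
          have : 0 ≤ (N * y) * (K * (1 - y)) := by
            apply mul_nonneg (by positivity); apply mul_nonneg <;> linarith
          linarith [mul_le_mul_of_nonneg_right hTs hy0]
        have h8 := mul_le_mul_of_nonneg_left heb' hNpos.le
        linarith
      exact le_of_mul_le_mul_right h6 hKy
    linarith
  refine ⟨by linarith, ?_⟩
  have hr0 : 0 < Real.sqrt lam := Real.sqrt_pos.mpr (by linarith)
  have hr2 : Real.sqrt lam * Real.sqrt lam = lam := Real.mul_self_sqrt (by linarith)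
  obtain ⟨r, hr⟩ : ∃ r, r = Real.sqrt lam := ⟨_, rfl⟩
  rw [← hr] at hl1 hl2 hr0 hr2 ⊢
  obtain ⟨Z, hZ⟩ : ∃ Z, Z = s ^ (lam - 2) := ⟨_, rfl⟩
  have hZpos : 0 < Z := by rw [hZ]; positivity
  have hZ1 : s ^ (lam - 1) = s * Z := by
    rw [hZ, show lam - 1 = 1 + (lam - 2) by ring, Real.rpow_add hspos, Real.rpow_one]
  have hZ2 : s ^ lam = s ^ 2 * Z := by
    rw [hZ, show lam = 2 + (lam - 2) by ring, Real.rpow_add hspos]; norm_num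
  have hsgsq : sg ^ 2 = lam ^ 2 * c ^ lam := by rw [hsg, ← hP]; ring
  rw [hZ1, ← hZ, ← hsgsq]
  -- error terms
  have e1 : C * (r - N / T + N * sg * e) ^ 2 / 2 ≤ sg ^ 2 / 4 + N * sg ^ 2 * e / 4 := by
    have a1 : (r - N / T + N * sg * e) ^ 2 ≤ 2 * (r - N / T) ^ 2 + 2 * (N * sg * e) ^ 2 := by
      nlinarith [sq_nonneg (r - N / T - N * sg * e)]
    have a2 : (r - N / T) ^ 2 ≤ lam := by
      have : 0 < N / T := by positivity
      have h7 : (r - N / T) ^ 2 ≤ r ^ 2 := pow_le_pow_left₀ (by linarith) (by linarith) 2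
      linarith [sq r]
    have a3 : lam ≤ sg ^ 2 / 4 := by nlinarith
    have a4 : C * (N * sg * e) ^ 2 ≤ N * sg ^ 2 * e / 4 := by
      have : 0 ≤ N * sg ^ 2 * e := by positivity
      have h8 : C * (N * sg * e) ^ 2 = (C * N) * e * (N * sg ^ 2 * e) := by ring
      have h9 : (C * N) * e ≤ 1 / 4 := by
        linarith [mul_le_mul_of_nonneg_left he1 (mul_pos hC0 hNpos).le]
      rw [h8]; linarith [mul_le_mul_of_nonneg_right h9 this]
    have a5 : C * (r - N / T) ^ 2 ≤ sg ^ 2 / 4 := by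
      linarith [mul_le_mul_of_nonneg_right hC1 (sq_nonneg (r - N / T))]
    linarith [mul_le_mul_of_nonneg_left a1 hC0.le]
  have e2 : r * (lam * (s * Z)) ≤ lam ^ 2 * Z / 4 := by
    have : r * s ≤ lam / 4 := by
      linarith [mul_le_mul_of_nonneg_left (by linarith : 4 * s ≤ r) hr0.le]
    have h := mul_le_mul_of_nonneg_right this (by positivity : 0 ≤ lam * Z)
    linarith
  have e3 : n * (lam ^ 2 * Z) / 2 ≤ -n * (-(lam * ((lam - 1) * Z))) := by
    have h : 0 ≤ n * Z * (lam * (lam - 2)) := by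
      apply mul_nonneg <;> apply mul_nonneg <;> linarith
    linarith
  suffices h : 5 / 4 * sg ^ 2 ≤ lam ^ 2 * Z * (n / 2 - 1 / 4) + N * sg ^ 2 * e / 4 by
    linarith
  have hLZ : 0 < lam ^ 2 * Z := by positivity
  have hq0 : 0 ≤ N * sg ^ 2 * e / 4 := by positivity
  rcases le_total t (T / 2) with htt | htt
  · have h1 : (c + T / 2) ^ lam ≤ s ^ lam :=
      Real.rpow_le_rpow (by positivity) (by linarith) (by linarith)
    have h2 : 10 * (T + c) ^ 2 * c ^ lam ≤ s ^ 2 * Z := by rw [← hZ2]; linarith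
    have h3 : s ^ 2 ≤ (T + c) ^ 2 := by
      apply pow_le_pow_left₀ hspos.le; linarith
    have h4 : 10 * c ^ lam ≤ Z := by
      have h5 : (T + c) ^ 2 * (10 * c ^ lam) ≤ (T + c) ^ 2 * Z := by
        nlinarith [mul_le_mul_of_nonneg_right h3 hZpos.le]
      exact le_of_mul_le_mul_left h5 (by positivity)
    have h6 : 10 * sg ^ 2 ≤ lam ^ 2 * Z := by
      rw [hsgsq]; linarith [mul_le_mul_of_nonneg_left h4 (sq_nonneg lam)]
    have h7 := mul_le_mul_of_nonneg_left (by linarith : 1 / 8 ≤ n / 2 - 1 / 4) hLZ.le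
    linarith
  · rcases le_total (1 / 4) e with h4 | h4
    · have hN40 : 40 ≤ N := by rw [hN]; nlinarith
      have h5 : 0 ≤ lam ^ 2 * Z * (n / 2 - 1 / 4) := mul_nonneg hLZ.le (by linarith)
      have h6 : 10 ≤ N * e := by
        linarith [mul_le_mul_of_nonneg_left h4 hNpos.le]
      have h7 := mul_le_mul_of_nonneg_right h6 (sq_nonneg sg)
      linarith
    · have h5 : 1 / 2 ≤ t / T := by rw [le_div_iff₀ hT]; linarith
      have h6 : N / 8 ≤ n / 2 - 1 / 4 := by
        rw [hn]
        linarith [mul_le_mul_of_nonneg_left (by linarith : 1 / 4 ≤ t / T - e) hNpos.le]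
      have h7 : c ^ lam ≤ c ^ 2 * Z := by
        have h8 : c ^ (lam - 2) ≤ Z := by
          rw [hZ]; exact Real.rpow_le_rpow (by positivity) (by linarith) (by linarith)
        have h9 : c ^ lam = c ^ 2 * c ^ (lam - 2) := by
          conv_lhs => rw [show lam = 2 + (lam - 2) by ring]
          rw [Real.rpow_add hcpos]; norm_num
        rw [h9]; gcongr
      have h10 : sg ^ 2 ≤ lam ^ 2 * (c ^ 2 * Z) := by rw [hsgsq]; gcongr
      have h11 := mul_le_mul_of_nonneg_left h6 hLZ.le
      have h12 : lam ^ 2 * Z * (N / 8) = 5 / 4 * (lam ^ 2 * (c ^ 2 * Z)) := by rw [hN]; ring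
      linarith

lemma carleman_core (T : ℝ) (hT : 0 < T) (C g a : ℝ) (hC : 0 ≤ C)
    (E q q1 n n1 k k1 : ℝ → ℝ) (hEn : ∀ t, 0 ≤ E t)
    (hEd : ∀ t, HasDerivAt E (-2 * q t * E t) t) (hqd : ∀ t, HasDerivAt q (q1 t) t)
    (hnd : ∀ t, HasDerivAt n (n1 t) t) (hkd : ∀ t, HasDerivAt k (k1 t) t)
    (hq1 : Continuous q1) (hn1 : Continuous n1) (hk1 : Continuous k1)
    (hg : ∀ t, k t + n1 t = g)
    (hn : ∀ t ∈ Set.Icc 0 T, 0 ≤ n t) (hCn : ∀ t ∈ Set.Icc 0 T, C * n t ≤ 1)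
    (hD : ∀ t ∈ Set.Icc 0 T, a ≤ -n t * q1 t - g * q t + k1 t / 2 - C * k t ^ 2 / 2)
    (u ux ut uxx uxt : ℝ → ℝ → ℝ)
    (cux : Continuous (fun p : ℝ × ℝ => ux p.1 p.2))
    (cut : Continuous (fun p : ℝ × ℝ => ut p.1 p.2))
    (cuxx : Continuous (fun p : ℝ × ℝ => uxx p.1 p.2))
    (cuxt : Continuous (fun p : ℝ × ℝ => uxt p.1 p.2))
    (cu : Continuous (fun p : ℝ × ℝ => u p.1 p.2))
    (dx : ∀ x t, HasDerivAt (fun y => u y t) (ux x t) x)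
    (dt : ∀ x t, HasDerivAt (fun s => u x s) (ut x t) t)
    (dxx : ∀ x t, HasDerivAt (fun y => ux y t) (uxx x t) x)
    (dxt : ∀ x t, HasDerivAt (fun s => ux x s) (uxt x t) t)
    (dtx : ∀ x t, HasDerivAt (fun y => ut y t) (uxt x t) x)
    (hN : ∀ t ∈ Set.Icc 0 T, ux 0 t = 0 ∧ ux 1 t = 0) :
    C * g * (∫ t in (0 : ℝ)..T, ∫ x in (0 : ℝ)..1, ux x t ^ 2 * E t)
      + C * a * (∫ t in (0 : ℝ)..T, ∫ x in (0 : ℝ)..1, u x t ^ 2 * E t) ≤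
    C * (∫ x in (0 : ℝ)..1,
        ((k T / 2 * u x T ^ 2 + n T * ux x T ^ 2 - n T * q T * u x T ^ 2) * E T
        - (k 0 / 2 * u x 0 ^ 2 + n 0 * ux x 0 ^ 2 - n 0 * q 0 * u x 0 ^ 2) * E 0))
      + ∫ t in (0 : ℝ)..T, ∫ x in (0 : ℝ)..1, (ut x t + uxx x t) ^ 2 * E t := by
  have cE : Continuous E := continuous_iff_continuousAt.mpr fun t => (hEd t).continuousAt
  have cq : Continuous q := continuous_iff_continuousAt.mpr fun t => (hqd t).continuousAt
  have cn : Continuous n := continuous_iff_continuousAt.mpr fun t => (hnd t).continuousAt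
  have ck : Continuous k := continuous_iff_continuousAt.mpr fun t => (hkd t).continuousAt
  set G' : ℝ → ℝ → ℝ := fun x t =>
    (k1 t / 2 * u x t ^ 2 + k t * u x t * ut x t + n1 t * ux x t ^ 2 + n t * (2 * ux x t * uxt x t)
          - (n1 t * q t + n t * q1 t) * u x t ^ 2 - n t * q t * (2 * u x t * ut x t)) * E t
          + (k t / 2 * u x t ^ 2 + n t * ux x t ^ 2 - n t * q t * u x t ^ 2) * (-2 * q t * E t)
    with hG'
  set H' : ℝ → ℝ → ℝ := fun x t =>
    (k t * (ux x t * ux x t + u x t * uxx x t)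
      - 2 * n t * ((uxt x t - q t * ux x t) * ux x t + (ut x t - q t * u x t) * uxx x t)) * E t
    with hH'
  have cG' : Continuous (fun p : ℝ × ℝ => G' p.1 p.2) := by
    simp only [hG']; fun_prop
  have cH' : Continuous (fun p : ℝ × ℝ => H' p.1 p.2) := by
    simp only [hH']; fun_prop
  have iG := int_t T (fun x t =>
    (k t / 2 * u x t ^ 2 + n t * ux x t ^ 2 - n t * q t * u x t ^ 2) * E t) G' cG' (by
      intro x t
      have h := (((((hkd t).div_const 2).mul ((dt x t).pow 2)).add
        ((hnd t).mul ((dxt x t).pow 2))).sub (((hnd t).mul (hqd t)).mul ((dt x t).pow 2))).mul (hEd t)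
      refine h.congr_deriv ?_
      simp only [hG', Pi.add_apply, Pi.sub_apply, Pi.mul_apply, Pi.pow_apply]
      push_cast
      ring)
  have iH := int_x T (fun x t =>
    (k t * (u x t * ux x t) - 2 * n t * ((ut x t - q t * u x t) * ux x t)) * E t) H' cH' (by
      intro x t
      have h := ((((dx x t).mul (dxx x t)).const_mul (k t)).sub
        ((((dtx x t).sub ((dx x t).const_mul (q t))).mul (dxx x t)).const_mul (2 * n t))).mul_const (E t)
      exact h) (by
      intro t ht
      rw [Set.uIcc_of_le hT.le] at ht
      simp [(hN t ht).1, (hN t ht).2])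
  have cx : ∀ (f : ℝ → ℝ → ℝ), Continuous (fun p : ℝ × ℝ => f p.1 p.2) → ∀ t,
      IntervalIntegrable (fun x => f x t) volume 0 1 := fun f hf t =>
    (hf.comp (by fun_prop : Continuous (fun x : ℝ => (x, t)))).intervalIntegrable _ _
  have ct : ∀ (f : ℝ → ℝ → ℝ), Continuous (fun p : ℝ × ℝ => f p.1 p.2) →
      IntervalIntegrable (fun t => ∫ x in (0 : ℝ)..1, f x t) volume 0 T := fun f hf =>
    (cont_inner f hf).intervalIntegrable _ _
  have iadd : ∀ (f h : ℝ → ℝ → ℝ), Continuous (fun p : ℝ × ℝ => f p.1 p.2) →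
      Continuous (fun p : ℝ × ℝ => h p.1 p.2) →
      ∫ t in (0 : ℝ)..T, ∫ x in (0 : ℝ)..1, (f x t + h x t) =
      (∫ t in (0 : ℝ)..T, ∫ x in (0 : ℝ)..1, f x t) + ∫ t in (0 : ℝ)..T, ∫ x in (0 : ℝ)..1, h x t := by
    intro f h hf hh
    rw [← intervalIntegral.integral_add (ct f hf) (ct h hh)]
    apply intervalIntegral.integral_congr
    intro t _
    exact intervalIntegral.integral_add (cx f hf t) (cx h hh t)
  have imul : ∀ (b : ℝ) (f : ℝ → ℝ → ℝ),
      ∫ t in (0 : ℝ)..T, ∫ x in (0 : ℝ)..1, (b * f x t) =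
      b * ∫ t in (0 : ℝ)..T, ∫ x in (0 : ℝ)..1, f x t := by
    intro b f
    simp only [intervalIntegral.integral_const_mul]
  have c1 : Continuous (fun p : ℝ × ℝ => ux p.1 p.2 ^ 2 * E p.2) := by fun_prop
  have c2 : Continuous (fun p : ℝ × ℝ => u p.1 p.2 ^ 2 * E p.2) := by fun_prop
  have c3 : Continuous (fun p : ℝ × ℝ => (ut p.1 p.2 + uxx p.1 p.2) ^ 2 * E p.2) := by fun_prop
  have main : ∫ t in (0 : ℝ)..T, ∫ x in (0 : ℝ)..1,
        (C * g * (ux x t ^ 2 * E t) + C * a * (u x t ^ 2 * E t)) ≤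
      ∫ t in (0 : ℝ)..T, ∫ x in (0 : ℝ)..1,
        (C * G' x t + C * H' x t + (ut x t + uxx x t) ^ 2 * E t) := by
    apply intervalIntegral.integral_mono_on hT.le
    · exact ct (fun x t => C * g * (ux x t ^ 2 * E t) + C * a * (u x t ^ 2 * E t))
        ((c1.const_mul _).add (c2.const_mul _))
    · exact ct (fun x t => C * G' x t + C * H' x t + (ut x t + uxx x t) ^ 2 * E t)
        (((cG'.const_mul _).add (cH'.const_mul _)).add c3)
    intro t ht
    apply intervalIntegral.integral_mono_on zero_le_one
    · exact cx (fun x t => C * g * (ux x t ^ 2 * E t) + C * a * (u x t ^ 2 * E t))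
        ((c1.const_mul _).add (c2.const_mul _)) t
    · exact cx (fun x t => C * G' x t + C * H' x t + (ut x t + uxx x t) ^ 2 * E t)
        (((cG'.const_mul _).add (cH'.const_mul _)).add c3) t
    intro x _
    exact pointwise_ineq _ _ _ _ _ _ _ _ _ _ _ _ _ _ _ (hEn t) hC (hg t) (hn t ht) (hCn t ht) (hD t ht)
  rw [iadd (fun x t => C * g * (ux x t ^ 2 * E t)) (fun x t => C * a * (u x t ^ 2 * E t))
      (c1.const_mul _) (c2.const_mul _),
    iadd (fun x t => C * G' x t + C * H' x t) (fun x t => (ut x t + uxx x t) ^ 2 * E t)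
      ((cG'.const_mul _).add (cH'.const_mul _)) c3,
    iadd (fun x t => C * G' x t) (fun x t => C * H' x t) (cG'.const_mul _) (cH'.const_mul _),
    imul (C * g) (fun x t => ux x t ^ 2 * E t), imul (C * a) (fun x t => u x t ^ 2 * E t),
    imul C G', imul C H', iG, iH] at main
  linarith

set_option maxHeartbeats 4000000 in
/-- One-dimensional Carleman estimate for the operator `∂ₜ + ∂ₓₓ` on `(0,1) × (0,T)`
with zero Neumann boundary conditions at `x = 0` and `x = 1`. -/
theorem stmt0 (T c : ℝ) (hT : 0 < T) (hc : 1 + Real.sqrt (1 + 2 * T) ≤ c) :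
    ∃ lam0 C1 : ℝ, 1 ≤ lam0 ∧ 0 < C1 ∧
      ∀ lam : ℝ, lam0 ≤ lam →
        ∀ u : ℝ → ℝ → ℝ,
          ContDiff ℝ 2 (fun p : ℝ × ℝ => u p.1 p.2) →
          (∀ t ∈ Set.Icc (0 : ℝ) T,
            deriv (fun x => u x t) 0 = 0 ∧ deriv (fun x => u x t) 1 = 0) →
          C1 * Real.sqrt lam *
              (∫ t in (0 : ℝ)..T, ∫ x in (0 : ℝ)..1,
                (deriv (fun y => u y t) x) ^ 2 * (carlemanWeight T c lam t) ^ 2)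
            + C1 * lam ^ 2 * c ^ lam *
              (∫ t in (0 : ℝ)..T, ∫ x in (0 : ℝ)..1,
                (u x t) ^ 2 * (carlemanWeight T c lam t) ^ 2)
            - C1 * Real.exp (2 * c ^ lam) *
              (∫ x in (0 : ℝ)..1, ((deriv (fun y => u y T) x) ^ 2 + (u x T) ^ 2))
            - C1 * lam * (T + c) ^ lam * Real.exp (2 * (T + c) ^ lam) *
              (∫ x in (0 : ℝ)..1, (u x 0) ^ 2)
          ≤ ∫ t in (0 : ℝ)..T, ∫ x in (0 : ℝ)..1,
              (deriv (fun s => u x s) t + deriv (fun y => deriv (fun z => u z t) y) x) ^ 2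
                * (carlemanWeight T c lam t) ^ 2 := by
  have hc2 : 2 ≤ c := by
    have : 1 ≤ Real.sqrt (1 + 2 * T) := Real.one_le_sqrt.mpr (by linarith)
    linarith
  have hcpos : 0 < c := by linarith
  obtain ⟨N, hN⟩ : ∃ N, N = 10 * c ^ 2 := ⟨_, rfl⟩
  have hNpos : 0 < N := by rw [hN]; positivity
  obtain ⟨C, hCdef⟩ : ∃ C, C = 1 / (4 * (1 + N)) := ⟨_, rfl⟩
  have hCpos : 0 < C := by rw [hCdef]; positivity
  have hCN : C * (1 + N) = 1 / 4 := by rw [hCdef]; field_simp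
  have hCN0 : 0 < C * N := mul_pos hCpos hNpos
  have p1 : 0 < (N / T) ^ 2 := by positivity
  have p2 : 0 < 16 * (T + c) ^ 2 := by positivity
  have p3 : 0 < 20 * c * (T + c) ^ 2 / T := by positivity
  have p4 : 0 < 4 * N / T := by positivity
  refine ⟨14 + (N / T) ^ 2 + 16 * (T + c) ^ 2 + 20 * c * (T + c) ^ 2 / T + 4 * N / T, C,
    by linarith, hCpos, ?_⟩
  intro lam hlam u hu hneu
  have hl : 14 ≤ lam := by linarith
  have hl1 : N / T ≤ Real.sqrt lam := Real.le_sqrt_of_sq_le (by linarith)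
  have hl2 : 4 * (T + c) ≤ Real.sqrt lam := Real.le_sqrt_of_sq_le (by nlinarith)
  have hl4 : 4 * N / T ≤ lam := by linarith
  have hl3 : 10 * (T + c) ^ 2 * c ^ lam ≤ (c + T / 2) ^ lam := by
    have h1 : 20 * c * (T + c) ^ 2 / T ≤ lam := by linarith
    have h2 : c + T / 2 = (1 + T / (2 * c)) * c := by field_simp
    rw [h2, Real.mul_rpow (by positivity) hcpos.le]
    have h3 : 1 + lam * (T / (2 * c)) ≤ (1 + T / (2 * c)) ^ lam :=
      one_add_mul_self_le_rpow_one_add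
        (by have : 0 < T / (2 * c) := by positivity
            linarith) (by linarith)
    have h4 : 10 * (T + c) ^ 2 ≤ lam * (T / (2 * c)) := by
      have h5 := mul_le_mul_of_nonneg_right h1 (by positivity : 0 ≤ T / (2 * c))
      have h6 : 20 * c * (T + c) ^ 2 / T * (T / (2 * c)) = 10 * (T + c) ^ 2 := by
        field_simp; ring
      linarith
    apply mul_le_mul_of_nonneg_right _ (by positivity)
    linarith
  obtain ⟨P, hPdef⟩ : ∃ P, P = c ^ (lam / 2) := ⟨_, rfl⟩
  have hP : P ^ 2 = c ^ lam := by
    rw [hPdef, ← Real.rpow_natCast, ← Real.rpow_mul hcpos.le]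
    congr 1; push_cast; ring
  have hPc : c ^ 7 ≤ P := by
    rw [hPdef, ← Real.rpow_natCast]
    apply Real.rpow_le_rpow_of_exponent_le (by linarith)
    push_cast; linarith
  have hP1 : 1 ≤ P := le_trans (one_le_pow₀ (by linarith)) hPc
  obtain ⟨sg, hsg⟩ : ∃ sg, sg = lam * P := ⟨_, rfl⟩
  obtain ⟨ux, ut, uxx, uxt, cux, cut, cuxx, cuxt, dx, dt, dxx, dxt, dtx⟩ := extract_derivs u hu
  have r1 : ∀ x t, deriv (fun y => u y t) x = ux x t := fun x t => (dx x t).deriv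
  have r2 : ∀ x t, deriv (fun s => u x s) t = ut x t := fun x t => (dt x t).deriv
  have r3 : ∀ x t, deriv (fun y => ux y t) x = uxx x t := fun x t => (dxx x t).deriv
  simp only [r1, r2, r3] at hneu ⊢
  have hs : ∀ t, HasDerivAt (fun t => T - t + c) (-1) t := fun t =>
    ((hasDerivAt_id t).const_sub T).add_const c
  have hpw : ∀ p : ℝ, 1 ≤ p → ∀ t, HasDerivAt (fun t => (T - t + c) ^ p)
      (-(p * (T - t + c) ^ (p - 1))) t := by
    intro p hp t
    refine ((hs t).rpow_const (Or.inr hp)).congr_deriv ?_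
    ring
  have hex : ∀ t, HasDerivAt (fun t => Real.exp (-(sg * (T - t))))
      (sg * Real.exp (-(sg * (T - t)))) t := by
    intro t
    refine ((((hasDerivAt_id t).const_sub T).const_mul sg).neg.exp).congr_deriv ?_
    simp [mul_comm]
  have hcont : ∀ p : ℝ, 0 ≤ p → Continuous (fun t => (T - t + c) ^ p) := fun p hp =>
    (Real.continuous_rpow_const hp).comp (by fun_prop)
  have core := carleman_core T hT C (Real.sqrt lam) (lam ^ 2 * c ^ lam) hCpos.le
    (fun t => carlemanWeight T c lam t ^ 2) (fun t => lam * (T - t + c) ^ (lam - 1))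
    (fun t => -(lam * ((lam - 1) * (T - t + c) ^ (lam - 2))))
    (fun t => 1 + N * (t / T - Real.exp (-(sg * (T - t)))))
    (fun t => N / T - N * sg * Real.exp (-(sg * (T - t))))
    (fun t => Real.sqrt lam - N / T + N * sg * Real.exp (-(sg * (T - t))))
    (fun t => N * sg ^ 2 * Real.exp (-(sg * (T - t))))
    (fun t => sq_nonneg _)
    (by
      intro t
      unfold carlemanWeight
      refine (((hpw lam (by linarith) t).exp).pow 2).congr_deriv ?_
      push_cast
      ring)
    (by
      intro t
      refine ((hpw (lam - 1) (by linarith) t).const_mul lam).congr_deriv ?_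
      rw [show lam - 1 - 1 = lam - 2 by ring]; ring)
    (by
      intro t
      refine (((((hasDerivAt_id t).div_const T).sub (hex t)).const_mul N).const_add 1).congr_deriv ?_
      ring)
    (by
      intro t
      refine (((hex t).const_mul (N * sg)).const_add (Real.sqrt lam - N / T)).congr_deriv ?_
      ring)
    (by
      have := hcont (lam - 2) (by linarith)
      fun_prop)
    (by fun_prop) (by fun_prop)
    (fun t => by ring)
    (fun t ht => (coeff_ineq T c lam (T - t + c) t N C _ sg P _ hT hc2 rfl ht.1 ht.2 hN hCpos
      (by linarith) (by linarith) hl hl1 hl2 hl3 hl4 hP hP1 hsg rfl rfl).1)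
    (by
      intro t ht
      have h1 : t / T ≤ 1 := (div_le_one hT).mpr ht.2
      have h2 := Real.exp_pos (-(sg * (T - t)))
      have h3 : C * N * (t / T - Real.exp (-(sg * (T - t)))) ≤ C * N * 1 :=
        mul_le_mul_of_nonneg_left (by linarith) hCN0.le
      linarith)
    (fun t ht => (coeff_ineq T c lam (T - t + c) t N C _ sg P _ hT hc2 rfl ht.1 ht.2 hN hCpos
      (by linarith) (by linarith) hl hl1 hl2 hl3 hl4 hP hP1 hsg rfl rfl).2)
    u ux ut uxx uxt cux cut cuxx cuxt hu.continuous dx dt dxx dxt dtx hneu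
  have cxT : ∀ (f : ℝ → ℝ → ℝ), Continuous (fun p : ℝ × ℝ => f p.1 p.2) → ∀ t,
      Continuous (fun x => f x t) := fun f hf t =>
    hf.comp (by fun_prop : Continuous (fun x : ℝ => (x, t)))
  have cu := cxT u hu.continuous
  have cux' := cxT ux cux
  have cuT := cu T
  have cu0 := cu 0
  have cuxT := cux' T
  have cux0 := cux' 0
  have ET : carlemanWeight T c lam T ^ 2 = Real.exp (2 * c ^ lam) := by
    unfold carlemanWeight
    rw [← Real.exp_nat_mul]; simp
  have E0 : carlemanWeight T c lam 0 ^ 2 = Real.exp (2 * (T + c) ^ lam) := by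
    unfold carlemanWeight
    rw [← Real.exp_nat_mul]; simp
  have bd : (∫ x in (0 : ℝ)..1, (Real.exp (2 * c ^ lam) * (ux x T ^ 2 + u x T ^ 2) +
        lam * (T + c) ^ lam * Real.exp (2 * (T + c) ^ lam) * u x 0 ^ 2)) =
      Real.exp (2 * c ^ lam) * (∫ x in (0 : ℝ)..1, (ux x T ^ 2 + u x T ^ 2)) +
      lam * (T + c) ^ lam * Real.exp (2 * (T + c) ^ lam) * ∫ x in (0 : ℝ)..1, u x 0 ^ 2 := by
    rw [intervalIntegral.integral_add, intervalIntegral.integral_const_mul,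
      intervalIntegral.integral_const_mul]
    · exact Continuous.intervalIntegrable (by fun_prop) _ _
    · exact Continuous.intervalIntegrable (by fun_prop) _ _
  have hbd := intervalIntegral.integral_mono_on (μ := volume) (a := (0 : ℝ)) (b := 1)
    (f := fun x => 
      ((Real.sqrt lam - N / T + N * sg * Real.exp (-(sg * (T - T)))) / 2 * u x T ^ 2
        + (1 + N * (T / T - Real.exp (-(sg * (T - T))))) * ux x T ^ 2
        - (1 + N * (T / T - Real.exp (-(sg * (T - T))))) * (lam * (T - T + c) ^ (lam - 1))
          * u x T ^ 2) * carlemanWeight T c lam T ^ 2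
      - ((Real.sqrt lam - N / T + N * sg * Real.exp (-(sg * (T - 0)))) / 2 * u x 0 ^ 2
        + (1 + N * (0 / T - Real.exp (-(sg * (T - 0))))) * ux x 0 ^ 2
        - (1 + N * (0 / T - Real.exp (-(sg * (T - 0))))) * (lam * (T - 0 + c) ^ (lam - 1))
          * u x 0 ^ 2) * carlemanWeight T c lam 0 ^ 2)
    (g := fun x => Real.exp (2 * c ^ lam) * (ux x T ^ 2 + u x T ^ 2) +
        lam * (T + c) ^ lam * Real.exp (2 * (T + c) ^ lam) * u x 0 ^ 2)
    zero_le_one (Continuous.intervalIntegrable (by fun_prop) _ _)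
    (Continuous.intervalIntegrable (by fun_prop) _ _) (by
      intro x _
      rw [ET, E0]
      have hn0 := (coeff_ineq T c lam (T - 0 + c) 0 N C _ sg P _ hT hc2 rfl le_rfl hT.le hN hCpos
        (by linarith) (by linarith) hl hl1 hl2 hl3 hl4 hP hP1 hsg rfl rfl).1
      have hexp0 := Real.exp_pos (-(sg * (T - 0)))
      simp only [sub_self, mul_zero, neg_zero, Real.exp_zero, div_self hT.ne', zero_add, add_zero,
        zero_div, mul_one, one_mul] at hn0 ⊢
      obtain ⟨n0, hn0d⟩ : ∃ n0, n0 = 1 + N * (0 - Real.exp (-(sg * (T - 0)))) := ⟨_, rfl⟩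
      rw [← hn0d] at hn0 ⊢
      have hn01 : n0 ≤ 1 := by
        rw [hn0d]; linarith [mul_pos hNpos hexp0]
      have hr2 : Real.sqrt lam * Real.sqrt lam = lam := Real.mul_self_sqrt (by linarith)
      have hsgpos : 0 < sg := by rw [hsg]; apply mul_pos <;> linarith
      have hk0 : 0 ≤ Real.sqrt lam - N / T + N * sg * Real.exp (-(sg * (T - 0))) := by
        have : 0 < N * sg * Real.exp (-(sg * (T - 0))) := by positivity
        linarith
      have hNT : 0 < N / T := by positivity
      have hq : P ^ 2 = c * c ^ (lam - 1) := by
        rw [hP]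
        conv_lhs => rw [show lam = 1 + (lam - 1) by ring]
        rw [Real.rpow_add hcpos, Real.rpow_one]
      -- coefficient at `T`
      have hkT : (Real.sqrt lam - N / T + N * sg) / 2 ≤ lam * c ^ (lam - 1) := by
        have b0 : Real.sqrt lam ≤ lam := by
          have : 1 ≤ Real.sqrt lam := Real.one_le_sqrt.mpr (by linarith)
          nlinarith
        have b1 : N * c ≤ P := by
          have : (10 : ℝ) ≤ c ^ 4 := by
            have := pow_le_pow_left₀ (by norm_num : (0 : ℝ) ≤ 2) hc2 4
            linarith
          have h3 := mul_le_mul_of_nonneg_right this (by positivity : 0 ≤ c ^ 3)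
          rw [hN]
          linarith
        have b2 : N * P ≤ c ^ (lam - 1) := by
          have h4 : c * (N * P) ≤ c * c ^ (lam - 1) := by
            rw [← hq]
            linarith [mul_le_mul_of_nonneg_right b1 (by linarith : 0 ≤ P)]
          exact le_of_mul_le_mul_left h4 hcpos
        have b3 : 1 ≤ c ^ (lam - 1) := Real.one_le_rpow (by linarith) (by linarith)
        have b4 : N * sg ≤ lam * c ^ (lam - 1) := by
          rw [hsg]
          linarith [mul_le_mul_of_nonneg_left b2 (by linarith : 0 ≤ lam)]
        have b5 := mul_le_mul_of_nonneg_left b3 (by linarith : 0 ≤ lam)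
        linarith
      have hTc : 1 ≤ T + c := by linarith
      have hq0 : n0 * (lam * (T - 0 + c) ^ (lam - 1)) ≤ lam * (T + c) ^ lam := by
        have h5 : (T - 0 + c) ^ (lam - 1) ≤ (T + c) ^ lam := by
          rw [sub_zero]
          exact Real.rpow_le_rpow_of_exponent_le hTc (by linarith)
        have h6 : 0 ≤ lam * (T - 0 + c) ^ (lam - 1) := by
          rw [sub_zero]; positivity
        have h7 := mul_le_mul_of_nonneg_right hn01 h6
        have h8 := mul_le_mul_of_nonneg_left h5 (by linarith : 0 ≤ lam)
        linarith
      have partT : ((Real.sqrt lam - N / T + N * sg) / 2 * u x T ^ 2 + ux x T ^ 2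
          - lam * c ^ (lam - 1) * u x T ^ 2) * Real.exp (2 * c ^ lam) ≤
          Real.exp (2 * c ^ lam) * (ux x T ^ 2 + u x T ^ 2) := by
        rw [mul_comm]
        apply mul_le_mul_of_nonneg_left _ (Real.exp_pos _).le
        linarith [mul_le_mul_of_nonneg_right hkT (sq_nonneg (u x T)), sq_nonneg (u x T)]
      have part0 : -(((Real.sqrt lam - N / T + N * sg * Real.exp (-(sg * (T - 0)))) / 2 * u x 0 ^ 2
          + n0 * ux x 0 ^ 2 - n0 * (lam * (T - 0 + c) ^ (lam - 1)) * u x 0 ^ 2))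
          * Real.exp (2 * (T + c) ^ lam) ≤
          lam * (T + c) ^ lam * u x 0 ^ 2 * Real.exp (2 * (T + c) ^ lam) := by
        apply mul_le_mul_of_nonneg_right _ (Real.exp_pos _).le
        linarith [mul_le_mul_of_nonneg_right hq0 (sq_nonneg (u x 0)),
          mul_nonneg hk0 (sq_nonneg (u x 0)), mul_nonneg hn0 (sq_nonneg (ux x 0))]
      linarith)
  rw [bd] at hbd
  have hfin := mul_le_mul_of_nonneg_left hbd hCpos.le
  linarith
end

section
/- Let T > 0, let c ≥ 1 + √(1 + 2T), let Ω ⊂ ℝⁿ be a bounded open set, and let K ⊂ Ω be a compact set. There exist a number λ₀ ≥ 1 and a constant C₁ > 0 (depending only on c, T, Ω) such that for every λ ≥ λ₀ and every u : ℝⁿ × [0,T] → ℝ of class C² with supp u(·,t) ⊆ K for every t ∈ [0,T], one has ∫₀ᵀ∫_Ω (∂ₜu + Δu)² φ_λ² dx dt ≥ C₁ √λ ∫₀ᵀ∫_Ω |∇u|² φ_λ² dx dt + C₁ λ² c^λ ∫₀ᵀ∫_Ω u² φ_λ² dx dt − C₁ e^{2c^λ} ∫_Ω (|∇u(x,T)|²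 + u²(x,T)) dx − C₁ λ (T+c)^λ e^{2(T+c)^λ} ∫_Ω u²(x,0) dx. -/
open MeasureTheory intervalIntegral

/-- The Laplacian of `f : ℝⁿ → ℝ`, defined as the sum of the pure second partial
derivatives in the coordinate directions. -/
noncomputable def lap {n : ℕ} (f : EuclideanSpace ℝ (Fin n) → ℝ)
    (x : EuclideanSpace ℝ (Fin n)) : ℝ :=
  ∑ i, iteratedFDeriv ℝ 2 f x ![EuclideanSpace.single i 1, EuclideanSpace.single i 1]

lemma cw_R_one (y : ℝ) (hy : 0 ≤ y) (K : ℕ) :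
    Real.cosh y ^ K ≤ Real.cosh (K * y) := by
  induction K with
  | zero => simp
  | succ n ih =>
    have h : ((n + 1 : ℕ) : ℝ) * y = n * y + y := by push_cast; ring
    rw [h, Real.cosh_add, pow_succ]
    have h1 := Real.cosh_pos y
    have h2 : 0 ≤ Real.sinh (n * y) := Real.sinh_nonneg_iff.2 (by positivity)
    have h3 : 0 ≤ Real.sinh y := Real.sinh_nonneg_iff.2 hy
    nlinarith [mul_nonneg h2 h3]

lemma cw_exp (y : ℝ) (K : ℕ) :
    Real.exp (K * y) = Real.cosh y ^ K * (1 + Real.tanh y) ^ K := by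
  rw [← mul_pow, Real.exp_nat_mul, Real.tanh_eq_sinh_div_cosh, mul_add,
    mul_div_cancel₀ _ (Real.cosh_pos y).ne', mul_one, Real.cosh_add_sinh]

lemma cw_tanh_nonneg (y : ℝ) (hy : 0 ≤ y) : 0 ≤ Real.tanh y := by
  rw [Real.tanh_eq_sinh_div_cosh]
  exact div_nonneg (Real.sinh_nonneg_iff.2 hy) (Real.cosh_pos y).le

lemma cw_R_upper (y : ℝ) (hy : 0 ≤ y) (K : ℕ) :
    Real.cosh (K * y) ≤ 2 ^ K * Real.cosh y ^ K := by
  have h1 : Real.cosh (K * y) ≤ Real.exp (K * y) := by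
    rw [Real.cosh_eq]
    have : Real.exp (-(K * y)) ≤ Real.exp (K * y) := by
      apply Real.exp_le_exp.2
      have : 0 ≤ K * y := by positivity
      linarith
    linarith
  refine h1.trans ?_
  rw [cw_exp, mul_comm]
  gcongr
  · have := cw_tanh_nonneg y hy; linarith
  · linarith [Real.tanh_lt_one y]

lemma cw_R_lower (y : ℝ) (hy : 0 ≤ y) (K : ℕ) :
    Real.cosh y ^ K * ((1 + K * Real.tanh y) / 2) ≤ Real.cosh (K * y) := by
  have h1 : Real.exp (K * y) / 2 ≤ Real.cosh (K * y) := by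
    rw [Real.cosh_eq]
    linarith [Real.exp_pos (-(K * y))]
  refine le_trans ?_ h1
  rw [cw_exp]
  have h2 := one_add_mul_le_pow (a := Real.tanh y) (by linarith [cw_tanh_nonneg y hy]) K
  have h3 := pow_pos (Real.cosh_pos y) K
  nlinarith

lemma cw_sech (y : ℝ) : 1 / Real.cosh y ^ 2 = 1 - Real.tanh y ^ 2 := by
  rw [Real.tanh_eq_sinh_div_cosh]
  have := (Real.cosh_pos y).ne'
  field_simp
  linarith [Real.cosh_sq y]

lemma cw_layer (y : ℝ) (K : ℕ) :
    1 - K * Real.tanh y ^ 2 ≤ (1 / Real.cosh y ^ K) ^ 2 := by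
  have h : (1 / Real.cosh y ^ K) ^ 2 = (1 + -(Real.tanh y ^ 2)) ^ K := by
    rw [← sub_eq_add_neg, ← cw_sech, div_pow, div_pow, one_pow, one_pow, ← pow_mul, ← pow_mul,
      mul_comm]
  rw [h]
  have hh : Real.tanh y ^ 2 ≤ 1 := by
    have := Real.tanh_sq_lt_one y
    linarith
  have := one_add_mul_le_pow (a := -(Real.tanh y ^ 2)) (by linarith) K
  linarith

lemma cw_tanh_deriv (y : ℝ) : HasDerivAt Real.tanh (1 / Real.cosh y ^ 2) y := by
  have h := (Real.hasDerivAt_sinh y).div (Real.hasDerivAt_cosh y) (Real.cosh_pos y).ne'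
  have e : Real.tanh = Real.sinh / Real.cosh := by
    funext z; simp [Real.tanh_eq_sinh_div_cosh]
  rw [e]
  have e2 : (1 : ℝ) / Real.cosh y ^ 2
      = (Real.cosh y * Real.cosh y - Real.sinh y * Real.sinh y) / Real.cosh y ^ 2 := by
    congr 1
    rw [← Real.cosh_sq_sub_sinh_sq y]; ring
  rw [e2]
  exact h

set_option maxHeartbeats 2000000 in
/-- The pointwise lower bound for the curvature of the modified weight. -/
lemma cw_curv (c T D lam s tau om y : ℝ) (K : ℕ) (hc : 2 ≤ c) (hT : 0 < T) (hD : 0 < D)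
    (hK : 384 * c ^ 2 ≤ K) (hlam : 2 ≤ lam)
    (h2 : 8 * Real.exp (2 * D * T) * (c + T) ≤ Real.sqrt lam)
    (h3 : 16 * c ^ 2 * Real.exp (2 * D * T) ≤ (1 + 1 / (2 * D) / c) ^ (lam - 2))
    (ht0 : 0 ≤ tau) (ht1 : tau ≤ T) (hs : s = c + tau)
    (hom : om ^ 2 = 12 * (lam ^ 2 * c ^ lam)) (hy : 0 ≤ y) :
    lam ^ 2 * c ^ lam + Real.sqrt lam * (lam * s ^ (lam - 1)) + lam / 2 ≤
      (lam * (lam - 1) * s ^ (lam - 2) + om ^ 2 * (1 / Real.cosh (K * y) ^ 2)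
        - om ^ 2 / K * (1 / Real.cosh y ^ 2)) *
      ((Real.cosh (K * y) / Real.cosh y ^ K) ^ 2 * Real.exp (-(2 * D * tau))) := by
  have hc0 : 0 < c := by linarith
  have hs0 : 0 < s := by linarith
  have hKpos : (0 : ℝ) < K := by nlinarith
  set R := Real.cosh (K * y) / Real.cosh y ^ K with hR
  have hCK : 0 < Real.cosh y ^ K := pow_pos (Real.cosh_pos y) K
  have hR1 : 1 ≤ R := by rw [hR, le_div_iff₀ hCK, one_mul]; exact cw_R_one y hy K
  set q := c ^ (lam - 2) with hq
  have hqpos : 0 < q := Real.rpow_pos_of_pos hc0 _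
  have hcl : c ^ lam = q * c ^ 2 := by
    rw [hq, ← Real.rpow_natCast, ← Real.rpow_add hc0]; congr 1; push_cast; ring
  set m := s ^ (lam - 2) with hm
  have hmpos : 0 < m := Real.rpow_pos_of_pos hs0 _
  have hsl : s ^ (lam - 1) = m * s := by
    rw [hm, ← Real.rpow_add_one hs0.ne']; congr 1; ring
  have hqm : q ≤ m := Real.rpow_le_rpow hc0.le (by linarith) (by linarith)
  set E := Real.exp (-(2 * D * tau)) with hE
  have hEpos : 0 < E := Real.exp_pos _
  have hEl : 1 ≤ E * Real.exp (2 * D * T) := by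
    rw [hE, ← Real.exp_add]; apply Real.one_le_exp; nlinarith
  have hR2 : 1 ≤ R ^ 2 := by nlinarith
  set S := 1 / Real.cosh (K * y) ^ 2 with hS
  have hSpos : 0 < S := by have := Real.cosh_pos (K * y); positivity
  have hq1 : 1 ≤ q := Real.one_le_rpow (by linarith) (by linarith)
  have hp : lam / 2 ≤ lam ^ 2 * c ^ lam := by
    rw [hcl]
    have : 1 ≤ q * c ^ 2 := by nlinarith
    nlinarith
  -- lower bound on the curvature
  have hcurv : lam ^ 2 / 4 * m + om ^ 2 * S ≤ lam * (lam - 1) * m + om ^ 2 * S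
        - om ^ 2 / K * (1 / Real.cosh y ^ 2) := by
    have e1 : om ^ 2 / K * (1 / Real.cosh y ^ 2) ≤ om ^ 2 / K * 1 := by
      gcongr
      rw [cw_sech]; nlinarith [sq_nonneg (Real.tanh y)]
    have e2 : om ^ 2 / K ≤ lam ^ 2 / 4 * m := by
      rw [div_le_iff₀ hKpos, hom, hcl]
      have : lam ^ 2 / 4 * m * (384 * c ^ 2) ≤ lam ^ 2 / 4 * m * K := by gcongr
      have : lam ^ 2 * c ^ 2 * q ≤ lam ^ 2 * c ^ 2 * m := by gcongr
      have hp3 : 0 < lam ^ 2 * c ^ 2 * m := by positivity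
      linarith
    have e3 : lam ^ 2 / 2 * m ≤ lam * (lam - 1) * m := by
      gcongr; nlinarith
    linarith
  have hA : Real.sqrt lam * (lam * (m * s)) ≤ lam ^ 2 / 8 * m * (R ^ 2 * E) := by
    have g1 : 8 * s ≤ Real.sqrt lam * E := by
      have : 8 * s * (E * Real.exp (2 * D * T)) ≤ Real.sqrt lam * E := by
        have : 8 * s * Real.exp (2 * D * T) ≤ Real.sqrt lam := by
          refine le_trans ?_ h2
          have : s * Real.exp (2 * D * T) ≤ (c + T) * Real.exp (2 * D * T) := by
            gcongr; linarith
          linarith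
        nlinarith
      nlinarith
    have hsq : Real.sqrt lam * Real.sqrt lam = lam := Real.mul_self_sqrt (by linarith)
    have hsp : 0 < Real.sqrt lam := Real.sqrt_pos.2 (by linarith)
    have g2 : Real.sqrt lam * (8 * s) ≤ lam * E := by nlinarith
    have g3 : E ≤ R ^ 2 * E := by nlinarith
    have g4 : lam * m * (Real.sqrt lam * (8 * s)) ≤ lam * m * (lam * E) := by gcongr
    have g5 : lam * m * (lam * E) ≤ lam * m * (lam * (R ^ 2 * E)) := by gcongr
    linarith
  have hB : 2 * (lam ^ 2 * c ^ lam) ≤ (lam ^ 2 / 8 * m + om ^ 2 * S) * (R ^ 2 * E) := by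
    have hRE : 0 < R ^ 2 * E := by positivity
    by_cases hcase : 1 / (2 * D) ≤ tau
    · have k1 : q * (16 * c ^ 2 * Real.exp (2 * D * T)) ≤ m := by
        have : q * (1 + 1 / (2 * D) / c) ^ (lam - 2) ≤ m := by
          rw [hq, ← Real.mul_rpow hc0.le (by positivity), hm]
          apply Real.rpow_le_rpow (by positivity) _ (by linarith)
          rw [mul_add, mul_div_cancel₀ _ hc0.ne']; linarith
        refine le_trans ?_ this
        gcongr
      have k2 : 16 * (q * c ^ 2) ≤ m * E := by
        have : q * (16 * c ^ 2) * (E * Real.exp (2 * D * T)) ≤ m * E := by nlinarith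
        have : q * (16 * c ^ 2) * 1 ≤ q * (16 * c ^ 2) * (E * Real.exp (2 * D * T)) := by gcongr
        linarith
      have k3 : m * E ≤ m * (R ^ 2 * E) := by
        gcongr; nlinarith
      rw [hcl]
      have k4 : lam ^ 2 / 8 * (16 * (q * c ^ 2)) ≤ lam ^ 2 / 8 * (m * (R ^ 2 * E)) :=
        mul_le_mul_of_nonneg_left (k2.trans k3) (by positivity)
      have k5 : 0 ≤ om ^ 2 * S * (R ^ 2 * E) := by positivity
      linarith
    · push Not at hcase
      have hE3 : 1 / 3 ≤ E := by
        have : Real.exp (-1) ≤ E := by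
          apply Real.exp_le_exp.2
          rw [lt_div_iff₀ (by positivity)] at hcase
          linarith
        refine le_trans ?_ this
        rw [Real.exp_neg, one_div]
        apply inv_anti₀ (Real.exp_pos _)
        linarith [Real.exp_one_lt_d9]
      by_cases hth : K * Real.tanh y ^ 2 ≤ 1 / 2
      · have k1 := cw_layer y K
        have k2 : S * R ^ 2 = (1 / Real.cosh y ^ K) ^ 2 := by
          rw [hS, hR]
          have := (Real.cosh_pos (K * y)).ne'
          field_simp
        have k3 : 1 / 2 ≤ S * R ^ 2 := by rw [k2]; linarith
        have k4 : 1 / 6 ≤ S * R ^ 2 * E := by nlinarith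
        have k5 : 0 ≤ lam ^ 2 / 8 * m * (R ^ 2 * E) := by positivity
        have k6 : om ^ 2 * (1 / 6) ≤ om ^ 2 * (S * R ^ 2 * E) := by gcongr
        linarith
      · push Not at hth
        have k1 : (1 + K * Real.tanh y) / 2 ≤ R := by
          rw [hR, le_div_iff₀ hCK, mul_comm]; exact cw_R_lower y hy K
        have htn := cw_tanh_nonneg y hy
        have k2 : K / 8 ≤ R ^ 2 := by
          have a1 : K * Real.tanh y / 2 ≤ R := by linarith
          have a2 : (K * Real.tanh y / 2) ^ 2 ≤ R ^ 2 := by gcongr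
          have a3 : (K : ℝ) * (1 / 2) ≤ K * (K * Real.tanh y ^ 2) := by gcongr
          linarith
        have k3 : 16 * c ^ 2 ≤ R ^ 2 * E := by nlinarith
        have k4 : lam ^ 2 / 8 * q * (16 * c ^ 2) ≤ lam ^ 2 / 8 * m * (R ^ 2 * E) := by gcongr
        have k5 : 0 ≤ om ^ 2 * S * (R ^ 2 * E) := by positivity
        rw [hcl]
        linarith
  rw [hsl]
  have hRE : 0 ≤ R ^ 2 * E := by positivity
  have := mul_le_mul_of_nonneg_right hcurv hRE
  linarith

set_option maxHeartbeats 1000000 in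
lemma cw_weight_deriv (T c D lam om : ℝ) (K : ℕ) (hK : (K : ℝ) ≠ 0) (t : ℝ) (hs : 0 < T - t + c) :
    HasDerivAt (fun t => Real.exp (2 * (T - t + c) ^ lam) *
      ((Real.cosh (K * (om * (T - t) / K)) / Real.cosh (om * (T - t) / K) ^ K) ^ 2
        * Real.exp (-(2 * D * (T - t)))))
      (-2 * (lam * (T - t + c) ^ (lam - 1) + om * (Real.tanh (K * (om * (T - t) / K))
          - Real.tanh (om * (T - t) / K)) - D) *
        (Real.exp (2 * (T - t + c) ^ lam) *
      ((Real.cosh (K * (om * (T - t) / K)) / Real.cosh (om * (T - t) / K) ^ K) ^ 2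
        * Real.exp (-(2 * D * (T - t)))))) t := by
  have d0 : HasDerivAt (fun t => T - t) (-1) t := by
    simpa using (hasDerivAt_id t).const_sub T
  have d1 : HasDerivAt (fun t => (T - t + c) ^ lam) (-(lam * (T - t + c) ^ (lam - 1))) t := by
    have := (d0.add_const c).rpow_const (p := lam) (Or.inl hs.ne')
    convert this using 1; ring
  have d2 := (d1.const_mul 2).exp
  have d3 : HasDerivAt (fun t => om * (T - t) / K) (-om / K) t := by
    refine ((d0.const_mul om).div_const (K : ℝ)).congr_deriv ?_
    ring
  have d4 : HasDerivAt (fun t => Real.cosh (om * (T - t) / K) ^ K)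
      (-om * Real.tanh (om * (T - t) / K) * Real.cosh (om * (T - t) / K) ^ K) t := by
    have := d3.cosh.pow K
    refine this.congr_deriv ?_
    have hK1 : K ≠ 0 := by exact_mod_cast hK
    obtain ⟨k, rfl⟩ := Nat.exists_eq_succ_of_ne_zero hK1
    rw [Real.tanh_eq_sinh_div_cosh, Nat.succ_eq_add_one, pow_succ, Nat.add_sub_cancel]
    have := (Real.cosh_pos (om * (T - t) / ((k + 1 : ℕ) : ℝ))).ne'
    have hk : ((k + 1 : ℕ) : ℝ) ≠ 0 := hK
    generalize ((k + 1 : ℕ) : ℝ) = kk at *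
    field_simp
  have d5 : HasDerivAt (fun t => Real.cosh (K * (om * (T - t) / K)))
      (-om * Real.tanh (K * (om * (T - t) / K)) * Real.cosh (K * (om * (T - t) / K))) t := by
    have := (d3.const_mul (K : ℝ)).cosh
    refine this.congr_deriv ?_
    rw [Real.tanh_eq_sinh_div_cosh]
    have := (Real.cosh_pos (K * (om * (T - t) / K))).ne'
    have hKK : (K : ℝ) * (-om / K) = -om := by field_simp
    rw [mul_assoc (-om), div_mul_cancel₀ _ this, hKK]; ring
  have hne : Real.cosh (om * (T - t) / K) ^ K ≠ 0 := (pow_pos (Real.cosh_pos _) K).ne'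
  have d6 := (d5.div d4 hne).pow 2
  have d7 : HasDerivAt (fun t => Real.exp (-(2 * D * (T - t))))
      (Real.exp (-(2 * D * (T - t))) * (2 * D)) t := by
    have hh : HasDerivAt (fun t => -(2 * D * (T - t))) (2 * D) t := by
      refine ((d0.const_mul (2 * D)).neg).congr_deriv ?_
      ring
    exact hh.exp
  refine (d2.mul (d6.mul d7)).congr_deriv ?_
  simp only [Pi.div_apply, Pi.pow_apply, Pi.mul_apply]
  generalize Real.tanh (K * (om * (T - t) / K)) = a1
  generalize Real.cosh (K * (om * (T - t) / K)) = a2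
  generalize Real.tanh (om * (T - t) / K) = a3
  revert hne
  generalize Real.cosh (om * (T - t) / K) ^ K = a4
  intro hne
  simp only [Nat.add_one_sub_one, pow_one, Nat.cast_ofNat]
  field_simp
  ring

lemma cw_b_deriv (T c D lam om : ℝ) (K : ℕ) (hK : (K : ℝ) ≠ 0) (t : ℝ) (hs : 0 < T - t + c) :
    HasDerivAt (fun t => lam * (T - t + c) ^ (lam - 1) + om * (Real.tanh (K * (om * (T - t) / K))
          - Real.tanh (om * (T - t) / K)) - D)
      (-(lam * (lam - 1) * (T - t + c) ^ (lam - 2)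
        + om ^ 2 * (1 / Real.cosh (K * (om * (T - t) / K)) ^ 2)
        - om ^ 2 / K * (1 / Real.cosh (om * (T - t) / K) ^ 2))) t := by
  have d0 : HasDerivAt (fun t => T - t) (-1) t := by
    simpa using (hasDerivAt_id t).const_sub T
  have d1 := (d0.add_const c).rpow_const (p := lam - 1) (Or.inl hs.ne')
  have d3 : HasDerivAt (fun t => om * (T - t) / K) (-om / K) t := by
    refine ((d0.const_mul om).div_const (K : ℝ)).congr_deriv ?_
    ring
  have d4 := (cw_tanh_deriv (om * (T - t) / K)).comp t d3
  have d5 := (cw_tanh_deriv (K * (om * (T - t) / K))).comp t (d3.const_mul (K : ℝ))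
  refine (((d1.const_mul lam).add ((d5.sub d4).const_mul om)).sub_const D).congr_deriv ?_
  have hKK : (K : ℝ) * (-om / K) = -om := by field_simp
  rw [show lam - 1 - 1 = lam - 2 by ring, hKK]
  ring

set_option maxHeartbeats 1000000 in
lemma cw_weight (T c : ℝ) (hT : 0 < T) (hc : 2 ≤ c) :
    ∃ lam0 M : ℝ, 1 ≤ lam0 ∧ 0 < M ∧ ∀ lam : ℝ, lam0 ≤ lam → ∃ W b b' : ℝ → ℝ,
      (∀ t ∈ Set.Icc 0 T, HasDerivAt W (-2 * b t * W t) t ∧ HasDerivAt b (b' t) t ∧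
        0 ≤ W t ∧ W t ≤ M * Real.exp (2 * (T - t + c) ^ lam) ∧
        (lam ^ 2 * c ^ lam + Real.sqrt lam * (lam * (T - t + c) ^ (lam - 1)) + lam / 2) *
          Real.exp (2 * (T - t + c) ^ lam) ≤ - b' t * W t) ∧
      W T = Real.exp (2 * c ^ lam) ∧ Real.sqrt lam / 2 ≤ b T ∧
      W 0 * b 0 ≤ lam * (T + c) ^ lam * Real.exp (2 * (T + c) ^ lam) := by
  obtain ⟨K, hK⟩ := exists_nat_ge (384 * c ^ 2)
  have hKpos : (0 : ℝ) < K := by nlinarith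
  set D : ℝ := K * Real.log 2 / T with hD
  have hDpos : 0 < D := by have := Real.log_pos (by norm_num : (1 : ℝ) < 2); positivity
  have hDT : Real.exp (-(2 * D * T)) * (2 ^ K) ^ 2 = 1 := by
    have : Real.exp (2 * D * T) = (2 ^ K) ^ 2 := by
      have e : 2 * D * T = (K * Real.log 2) + (K * Real.log 2) := by rw [hD]; field_simp; ring
      rw [e, Real.exp_add, Real.exp_nat_mul, Real.exp_log (by norm_num)]; ring
    rw [← this, ← Real.exp_add]; simp
  have hc0 : 0 < c := by linarith
  have ev2 : ∀ᶠ lam : ℝ in Filter.atTop, 8 * Real.exp (2 * D * T) * (c + T) ≤ Real.sqrt lam :=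
    Real.tendsto_sqrt_atTop.eventually_ge_atTop _
  have ev3 : ∀ᶠ lam : ℝ in Filter.atTop,
      16 * c ^ 2 * Real.exp (2 * D * T) ≤ (1 + 1 / (2 * D) / c) ^ (lam - 2) := by
    have h1 : 1 < 1 + 1 / (2 * D) / c := by
      have : 0 < 1 / (2 * D) / c := by positivity
      linarith
    have h2 := (tendsto_rpow_atTop_of_base_gt_one _ h1).comp
      (Filter.tendsto_atTop_add_const_right Filter.atTop (-2 : ℝ) Filter.tendsto_id)
    exact h2.eventually_ge_atTop _
  obtain ⟨l0, hl0⟩ := Filter.eventually_atTop.1 (ev2.and (ev3.and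
    (Filter.eventually_ge_atTop (6 + 2 * D))))
  refine ⟨max l0 1, (2 ^ K) ^ 2, le_max_right _ _, by positivity, fun lam hlam => ?_⟩
  obtain ⟨h2, h3, h4⟩ := hl0 lam ((le_max_left _ _).trans hlam)
  have hlam6 : 6 ≤ lam := by linarith
  set om : ℝ := Real.sqrt (12 * (lam ^ 2 * c ^ lam)) with hom
  have hom0 : 0 ≤ om := Real.sqrt_nonneg _
  have hom2 : om ^ 2 = 12 * (lam ^ 2 * c ^ lam) := Real.sq_sqrt (by positivity)
  refine ⟨_, _, _, fun t ht => ⟨cw_weight_deriv T c D lam om K hKpos.ne' t (by linarith [ht.2]),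
    cw_b_deriv T c D lam om K hKpos.ne' t (by linarith [ht.2]), by positivity, ?_, ?_⟩, ?_, ?_, ?_⟩
  · have ht0 : 0 ≤ T - t := by linarith [ht.2]
    rw [mul_comm]
    gcongr
    have hy : 0 ≤ om * (T - t) / K := by positivity
    have hE : Real.exp (-(2 * D * (T - t))) ≤ 1 := by
      rw [Real.exp_le_one_iff]; have : 0 ≤ 2 * D * (T - t) := by positivity
      linarith
    have hR : Real.cosh (K * (om * (T - t) / K)) / Real.cosh (om * (T - t) / K) ^ K ≤ 2 ^ K := by
      rw [div_le_iff₀ (pow_pos (Real.cosh_pos _) K)]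
      exact cw_R_upper _ hy K
    calc _ ≤ ((2 : ℝ) ^ K) ^ 2 * 1 := by
          gcongr
      _ = _ := mul_one _
  · have ht0 : 0 ≤ T - t := by linarith [ht.2]
    have := cw_curv c T D lam (T - t + c) (T - t) om (om * (T - t) / K) K hc hT hDpos hK
      (by linarith) h2 h3 ht0 (by linarith [ht.1]) (by ring) hom2 (by positivity)
    have h5 := mul_le_mul_of_nonneg_right this (Real.exp_pos (2 * (T - t + c) ^ lam)).le
    rw [neg_neg]
    refine h5.trans (le_of_eq ?_)
    rw [mul_assoc, mul_comm (_ * _) (Real.exp (2 * (T - t + c) ^ lam))]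
  · simp
  · simp only [sub_self, zero_add, mul_zero, zero_div]
    have hs1 : Real.sqrt lam ≤ lam := by
      rw [Real.sqrt_le_left (by linarith)]; nlinarith
    have : 1 ≤ c ^ (lam - 1) := Real.one_le_rpow (by linarith) (by linarith)
    nlinarith
  · simp only [sub_zero]
    set y := om * T / K with hy
    have hy0 : 0 ≤ y := by positivity
    have hR : Real.cosh (K * y) / Real.cosh y ^ K ≤ 2 ^ K := by
      rw [div_le_iff₀ (pow_pos (Real.cosh_pos _) K)]
      exact cw_R_upper _ hy0 K
    have hR0 : 0 ≤ Real.cosh (K * y) / Real.cosh y ^ K :=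
      div_nonneg (Real.cosh_pos _).le (pow_pos (Real.cosh_pos _) K).le
    have hrho : (Real.cosh (K * y) / Real.cosh y ^ K) ^ 2 * Real.exp (-(2 * D * T)) ≤ 1 := by
      rw [← hDT, mul_comm]; gcongr
    set rho := (Real.cosh (K * y) / Real.cosh y ^ K) ^ 2 * Real.exp (-(2 * D * T)) with hrhod
    have hrho0 : 0 ≤ rho := by positivity
    have homb : om ≤ lam * (T + c) ^ (lam - 1) := by
      rw [hom]
      apply Real.sqrt_le_left (by positivity) |>.2
      have e1 : c ^ (lam - 1) ≤ (T + c) ^ (lam - 1) :=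
        Real.rpow_le_rpow hc0.le (by linarith) (by linarith)
      have e2 : 12 * c ^ lam ≤ (c ^ (lam - 1)) ^ 2 := by
        have : (c ^ (lam - 1)) ^ 2 = c ^ (lam - 2) * c ^ lam := by
          rw [← Real.rpow_natCast, ← Real.rpow_mul hc0.le, ← Real.rpow_add hc0]
          congr 1; push_cast; ring
        rw [this]
        gcongr
        have : c ^ (4 : ℝ) ≤ c ^ (lam - 2) :=
          Real.rpow_le_rpow_of_exponent_le (by linarith) (by linarith)
        refine le_trans ?_ this
        have : c ^ (4 : ℝ) = c ^ 4 := by norm_cast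
        rw [this]
        have : (2 : ℝ) ^ 4 ≤ c ^ 4 := by gcongr
        linarith
      have e3 : (c ^ (lam - 1)) ^ 2 ≤ ((T + c) ^ (lam - 1)) ^ 2 := by gcongr
      rw [mul_pow]
      nlinarith [sq_nonneg lam]
    have hb : lam * (T + c) ^ (lam - 1) + om * (Real.tanh (K * y) - Real.tanh y) - D
        ≤ lam * (T + c) ^ lam := by
      have e1 : (T + c) ^ lam = (T + c) ^ (lam - 1) * (T + c) := by
        rw [← Real.rpow_add_one (by positivity)]; congr 1; ring
      have e2 : om * (Real.tanh (K * y) - Real.tanh y) ≤ om * 1 := by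
        gcongr
        linarith [Real.tanh_lt_one (K * y), cw_tanh_nonneg y hy0]
      have e3 : lam * (T + c) ^ (lam - 1) * 2 ≤ lam * (T + c) ^ (lam - 1) * (T + c) := by
        gcongr; linarith
      rw [e1]; linarith
    have hp : 0 ≤ lam * (T + c) ^ lam := by positivity
    set B := lam * (T + c) ^ (lam - 1) + om * (Real.tanh (K * y) - Real.tanh y) - D
    have : rho * B ≤ lam * (T + c) ^ lam := by nlinarith
    calc Real.exp (2 * (T + c) ^ lam) * rho * B = (rho * B) * Real.exp (2 * (T + c) ^ lam) := by
          ring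
      _ ≤ _ := by gcongr

lemma cs_x {n : ℕ} {g : EuclideanSpace ℝ (Fin n) × ℝ → ℝ} {x : EuclideanSpace ℝ (Fin n)} {t : ℝ}
    (hg : DifferentiableAt ℝ g (x, t)) :
    HasFDerivAt (fun y => g (y, t)) ((fderiv ℝ g (x, t)).comp
      (ContinuousLinearMap.inl ℝ (EuclideanSpace ℝ (Fin n)) ℝ)) x :=
  hg.hasFDerivAt.comp x (hasFDerivAt_prodMk_left x t)

lemma cs_t {n : ℕ} {g : EuclideanSpace ℝ (Fin n) × ℝ → ℝ} {x : EuclideanSpace ℝ (Fin n)} {t : ℝ}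
    (hg : DifferentiableAt ℝ g (x, t)) :
    HasDerivAt (fun s => g (x, s)) (fderiv ℝ g (x, t) (0, 1)) t := by
  have := (hg.hasFDerivAt.comp t (hasFDerivAt_prodMk_right x t)).hasDerivAt
  refine HasDerivAt.congr_deriv (f := fun s => g (x, s)) this ?_
  simp

lemma cs_cont {n : ℕ} {g : EuclideanSpace ℝ (Fin n) × ℝ → ℝ} (hg : Continuous g)
    {K : Set (EuclideanSpace ℝ (Fin n))} (hK : IsCompact K) :
    Continuous (fun t => ∫ x in K, g (x, t)) :=
  continuous_parametric_integral_of_continuous (f := fun t x => g (x, t))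
    (hg.comp (by fun_prop)) hK

lemma cs_int {n : ℕ} {g : EuclideanSpace ℝ (Fin n) → ℝ} (hg : Continuous g)
    {K : Set (EuclideanSpace ℝ (Fin n))} (hK : IsCompact K) :
    Integrable g (volume.restrict K) :=
  hg.continuousOn.integrableOn_compact hK

lemma cs_deriv {n : ℕ} {g : EuclideanSpace ℝ (Fin n) × ℝ → ℝ} (hg : ContDiff ℝ 1 g)
    {K : Set (EuclideanSpace ℝ (Fin n))} (hK : IsCompact K) (t : ℝ) :
    HasDerivAt (fun t => ∫ x in K, g (x, t)) (∫ x in K, fderiv ℝ g (x, t) (0, 1)) t := by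
  have hd : Differentiable ℝ g := hg.differentiable (by norm_num)
  have hc : Continuous (fun p => fderiv ℝ g p (0, 1)) :=
    (hg.continuous_fderiv (by norm_num)).clm_apply continuous_const
  obtain ⟨M, hM⟩ := ((hK.prod (isCompact_Icc (a := t - 1) (b := t + 1))).bddAbove_image
    hc.norm.continuousOn)
  refine (hasDerivAt_integral_of_dominated_loc_of_deriv_le (μ := volume.restrict K)
    (F := fun s x => g (x, s)) (F' := fun s x => fderiv ℝ g (x, s) (0, 1)) (bound := fun _ => M)
    (s := Set.Icc (t - 1) (t + 1)) (Icc_mem_nhds (by linarith) (by linarith)) ?_ ?_ ?_ ?_ ?_ ?_).2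
  · exact Filter.Eventually.of_forall fun s =>
      (hg.continuous.comp (by fun_prop : Continuous fun x => (x, s))).aestronglyMeasurable
  · exact cs_int (hg.continuous.comp (by fun_prop : Continuous fun x => (x, t))) hK
  · exact (hc.comp (by fun_prop : Continuous fun x => (x, t))).aestronglyMeasurable
  · filter_upwards [ae_restrict_mem hK.measurableSet] with x hx s hs
    exact hM ⟨(x, s), ⟨hx, hs⟩, rfl⟩
  · exact cs_int continuous_const hK
  · exact Filter.Eventually.of_forall fun x s _ => cs_t (hd _)

lemma cs_fderiv_zero {n : ℕ} {f : EuclideanSpace ℝ (Fin n) → ℝ}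
    {K : Set (EuclideanSpace ℝ (Fin n))} (hK : IsCompact K) (h0 : ∀ x ∉ K, f x = 0)
    {x : EuclideanSpace ℝ (Fin n)} (hx : x ∉ K) : fderiv ℝ f x = 0 := by
  have : f =ᶠ[nhds x] fun _ => 0 := by
    filter_upwards [hK.isClosed.isOpen_compl.mem_nhds hx] with y hy using h0 y hy
  rw [this.fderiv_eq]; simp

lemma cs_ibp {n : ℕ} {f g : EuclideanSpace ℝ (Fin n) → ℝ} (hf : ContDiff ℝ 1 f)
    (hg : ContDiff ℝ 1 g) {K : Set (EuclideanSpace ℝ (Fin n))} (hK : IsCompact K)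
    (h0 : ∀ x ∉ K, f x = 0) (v : EuclideanSpace ℝ (Fin n)) :
    ∫ x in K, f x * fderiv ℝ g x v = - ∫ x in K, fderiv ℝ f x v * g x := by
  have h1 : ∀ x ∉ K, f x * fderiv ℝ g x v = 0 := fun x hx => by simp [h0 x hx]
  have h2 : ∀ x ∉ K, fderiv ℝ f x v * g x = 0 := fun x hx => by
    simp [cs_fderiv_zero hK h0 hx]
  have h3 : ∀ x ∉ K, f x * g x = 0 := fun x hx => by simp [h0 x hx]
  have c1 : Continuous (fun x => fderiv ℝ f x v) :=
    (hf.continuous_fderiv (by norm_num)).clm_apply continuous_const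
  have c2 : Continuous (fun x => fderiv ℝ g x v) :=
    (hg.continuous_fderiv (by norm_num)).clm_apply continuous_const
  rw [setIntegral_eq_integral_of_forall_compl_eq_zero h1,
    setIntegral_eq_integral_of_forall_compl_eq_zero h2]
  apply integral_mul_fderiv_eq_neg_fderiv_mul_of_integrable
  · exact (c1.mul hg.continuous).integrable_of_hasCompactSupport (HasCompactSupport.intro hK h2)
  · exact (hf.continuous.mul c2).integrable_of_hasCompactSupport (HasCompactSupport.intro hK h1)
  · exact (hf.continuous.mul hg.continuous).integrable_of_hasCompactSupport
      (HasCompactSupport.intro hK h3)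
  · exact fun x _ => hf.differentiable (by norm_num) x
  · exact fun x _ => hg.differentiable (by norm_num) x

/-- The algebra of the energy inequalities at a fixed time. -/
lemma cs_energy {n : ℕ} {p q r : EuclideanSpace ℝ (Fin n) → ℝ} (hp : Continuous p)
    (hq : Continuous q) (hr : Continuous r) {K : Set (EuclideanSpace ℝ (Fin n))}
    (hK : IsCompact K) (b : ℝ) :
    2 * b * (-∫ x in K, p x * r x) - 2 * b ^ 2 * (∫ x in K, p x ^ 2)
      + 2 * (∫ x in K, r x * q x) + b * (2 * ∫ x in K, p x * q x) ≤ ∫ x in K, (q x + r x) ^ 2 := by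
  have h0 : 0 ≤ ∫ x in K, ((q x - b * p x) ^ 2 + (r x + b * p x) ^ 2) :=
    integral_nonneg fun x => by positivity
  have e : (fun x => (q x - b * p x) ^ 2 + (r x + b * p x) ^ 2) = fun x => (q x + r x) ^ 2 +
      ((2 * b) * (p x * r x) + ((2 * b ^ 2) * p x ^ 2 + ((-2) * (r x * q x)
        + (- 2 * b) * (p x * q x)))) := by
    funext x; ring
  rw [e, integral_add (cs_int (by fun_prop) hK) (cs_int (by fun_prop) hK),
    integral_add (cs_int (by fun_prop) hK) (cs_int (by fun_prop) hK),
    integral_add (cs_int (by fun_prop) hK) (cs_int (by fun_prop) hK),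
    integral_add (cs_int (by fun_prop) hK) (cs_int (by fun_prop) hK),
    MeasureTheory.integral_const_mul, MeasureTheory.integral_const_mul, MeasureTheory.integral_const_mul, MeasureTheory.integral_const_mul] at h0
  linarith

lemma cs_energy2 {n : ℕ} {p q r : EuclideanSpace ℝ (Fin n) → ℝ} (hp : Continuous p)
    (hq : Continuous q) (hr : Continuous r) {K : Set (EuclideanSpace ℝ (Fin n))}
    (hK : IsCompact K) (m : ℝ) (hm : 0 < m) :
    m * (-∫ x in K, p x * r x) ≤ m * (∫ x in K, p x * q x) + (∫ x in K, (q x + r x) ^ 2) / 2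
      + m ^ 2 / 2 * (∫ x in K, p x ^ 2) := by
  have h0 : 0 ≤ ∫ x in K, ((q x + r x) + m * p x) ^ 2 :=
    integral_nonneg fun x => by positivity
  have e : (fun x => ((q x + r x) + m * p x) ^ 2) = fun x => (q x + r x) ^ 2 +
      ((2 * m) * (p x * r x) + (m ^ 2 * p x ^ 2 + (2 * m) * (p x * q x))) := by
    funext x; ring
  rw [e, integral_add (cs_int (by fun_prop) hK) (cs_int (by fun_prop) hK),
    integral_add (cs_int (by fun_prop) hK) (cs_int (by fun_prop) hK),
    integral_add (cs_int (by fun_prop) hK) (cs_int (by fun_prop) hK),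
    MeasureTheory.integral_const_mul, MeasureTheory.integral_const_mul, MeasureTheory.integral_const_mul] at h0
  linarith

lemma cs_grad {n : ℕ} {f : EuclideanSpace ℝ (Fin n) → ℝ} (x : EuclideanSpace ℝ (Fin n)) :
    ‖gradient f x‖ ^ 2 = ∑ i, (fderiv ℝ f x (EuclideanSpace.single i 1)) ^ 2 := by
  rw [EuclideanSpace.norm_sq_eq]
  refine Finset.sum_congr rfl fun i _ => ?_
  have : (gradient f x) i = fderiv ℝ f x (EuclideanSpace.single i 1) := by
    have h := EuclideanSpace.inner_single_right (𝕜 := ℝ) i (1 : ℝ) (gradient f x)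
    rw [gradient, InnerProductSpace.toDual_symm_apply] at h
    simpa [gradient] using h.symm
  rw [Real.norm_eq_abs, sq_abs, this]

lemma cs_lap {n : ℕ} {U : EuclideanSpace ℝ (Fin n) × ℝ → ℝ} (hU : ContDiff ℝ 2 U)
    (x : EuclideanSpace ℝ (Fin n)) (t : ℝ) :
    lap (fun y => U (y, t)) x = ∑ i : Fin n, fderiv ℝ (fun p => fderiv ℝ U p
      (EuclideanSpace.single i 1, 0)) (x, t) (EuclideanSpace.single i 1, 0) := by
  unfold lap
  refine Finset.sum_congr rfl fun i _ => ?_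
  rw [iteratedFDeriv_two_apply]
  simp only [Matrix.cons_val_zero, Matrix.cons_val_one]
  have hd : Differentiable ℝ U := hU.differentiable (by norm_num)
  have hf : ContDiff ℝ 2 (fun y => U (y, t)) := hU.comp (by fun_prop)
  have hf1 : Differentiable ℝ (fderiv ℝ (fun y => U (y, t))) :=
    (hf.fderiv_right (m := 1) (by norm_num)).differentiable (by norm_num)
  have hu1 : Differentiable ℝ (fderiv ℝ U) :=
    (hU.fderiv_right (m := 1) (by norm_num)).differentiable (by norm_num)
  have e1 : fderiv ℝ (fun y => fderiv ℝ (fun y => U (y, t)) y (EuclideanSpace.single i 1)) x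
      (EuclideanSpace.single i 1) = fderiv ℝ (fderiv ℝ (fun y => U (y, t))) x
      (EuclideanSpace.single i 1) (EuclideanSpace.single i 1) := by
    rw [fderiv_clm_apply (hf1 x) (differentiableAt_const _)]
    simp
  rw [← e1]
  have e2 : (fun y => fderiv ℝ (fun y => U (y, t)) y (EuclideanSpace.single i 1))
      = fun y => (fun p => fderiv ℝ U p (EuclideanSpace.single i 1, 0)) (y, t) := by
    funext y
    rw [(cs_x (hd (y, t))).fderiv]
    simp
  rw [e2, (cs_x (g := fun p => fderiv ℝ U p (EuclideanSpace.single i 1, 0))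
    ((hu1 (x, t)).clm_apply (differentiableAt_const _))).fderiv]
  simp

set_option maxHeartbeats 1000000 in
lemma cs_main {n : ℕ} {T : ℝ} {Ω K : Set (EuclideanSpace ℝ (Fin n))} (hK : IsCompact K)
    (hKΩ : K ⊆ Ω) (u : EuclideanSpace ℝ (Fin n) → ℝ → ℝ)
    (hu : ContDiff ℝ 2 (fun p : EuclideanSpace ℝ (Fin n) × ℝ => u p.1 p.2))
    (hsupp : ∀ t ∈ Set.Icc (0 : ℝ) T, Function.support (fun x => u x t) ⊆ K) :
    ∃ J D F J' D' : ℝ → ℝ, Continuous J ∧ Continuous D ∧ Continuous F ∧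
      (∀ t, 0 ≤ J t) ∧ (∀ t, 0 ≤ D t) ∧
      (∀ t ∈ Set.Icc (0 : ℝ) T, ∫ x in Ω, (u x t) ^ 2 = J t) ∧
      (∀ t ∈ Set.Icc (0 : ℝ) T, ∫ x in Ω, ‖gradient (fun y => u y t) x‖ ^ 2 = D t) ∧
      (∫ x in Ω, (‖gradient (fun y => u y T) x‖ ^ 2 + (u x T) ^ 2) = D T + J T ∨ T < 0) ∧
      (∀ t ∈ Set.Ioo (0 : ℝ) T,
        ∫ x in Ω, (deriv (fun s => u x s) t + lap (fun y => u y t) x) ^ 2 = F t) ∧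
      (∀ t, HasDerivAt J (J' t) t) ∧ (∀ t, HasDerivAt D (D' t) t) ∧
      (∀ t ∈ Set.Ioo (0 : ℝ) T, ∀ b : ℝ,
        2 * b * D t - 2 * b ^ 2 * J t - D' t + b * J' t ≤ F t) ∧
      (∀ t ∈ Set.Ioo (0 : ℝ) T, ∀ m : ℝ, 0 < m →
        m * D t ≤ m * (J' t / 2) + F t / 2 + m ^ 2 / 2 * J t) := by
  obtain ⟨U, hUdef⟩ : ∃ U : EuclideanSpace ℝ (Fin n) × ℝ → ℝ, U = fun p => u p.1 p.2 := ⟨_, rfl⟩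
  rw [← hUdef] at hu
  have huU : ∀ x t, u x t = U (x, t) := fun x t => by rw [hUdef]
  simp only [huU] at hsupp ⊢
  clear huU hUdef
  obtain ⟨e, he⟩ : ∃ e : Fin n → EuclideanSpace ℝ (Fin n) × ℝ,
    e = fun i => (EuclideanSpace.single i 1, 0) := ⟨_, rfl⟩
  have hd : Differentiable ℝ U := hu.differentiable (by norm_num)
  have hu1 : ContDiff ℝ 1 (fderiv ℝ U) := hu.fderiv_right (m := 1) (by norm_num)
  obtain ⟨ut, hut⟩ : ∃ ut : EuclideanSpace ℝ (Fin n) × ℝ → ℝ,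
    ut = fun p => fderiv ℝ U p (0, 1) := ⟨_, rfl⟩
  obtain ⟨ui, hui⟩ : ∃ ui : Fin n → EuclideanSpace ℝ (Fin n) × ℝ → ℝ,
    ui = fun i p => fderiv ℝ U p (e i) := ⟨_, rfl⟩
  have hutC : ContDiff ℝ 1 ut := by rw [hut]; exact hu1.clm_apply contDiff_const
  have huiC : ∀ i, ContDiff ℝ 1 (ui i) := fun i => by rw [hui]; exact hu1.clm_apply contDiff_const
  obtain ⟨L, hL⟩ : ∃ L : EuclideanSpace ℝ (Fin n) × ℝ → ℝ,
    L = fun p => ∑ i, fderiv ℝ (ui i) p (e i) := ⟨_, rfl⟩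
  have huiiC : ∀ i v, Continuous (fun p => fderiv ℝ (ui i) p v) := fun i v =>
    ((huiC i).continuous_fderiv (by norm_num)).clm_apply continuous_const
  have hLC : Continuous L := by
    rw [hL]; exact continuous_finsetSum _ fun i _ => huiiC i (e i)
  have hUc : Continuous U := hu.continuous
  have hutc : Continuous ut := hutC.continuous
  have huic : ∀ i, Continuous (ui i) := fun i => (huiC i).continuous
  -- symmetry of second derivatives
  have hsymm : ∀ i p, fderiv ℝ (ui i) p (0, 1) = fderiv ℝ ut p (e i) := by
    intro i p
    have h2 : IsSymmSndFDerivAt ℝ U p :=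
      hu.contDiffAt.isSymmSndFDerivAt (by simp)
    have hdf : DifferentiableAt ℝ (fderiv ℝ U) p := hu1.differentiable (by norm_num) p
    rw [hui, hut]
    simp only
    rw [fderiv_clm_apply hdf (differentiableAt_const _),
      fderiv_clm_apply hdf (differentiableAt_const _)]
    simpa using h2 (0, 1) (e i)
  -- vanishing off K
  have hz : ∀ t ∈ Set.Icc (0 : ℝ) T, ∀ x ∉ K, U (x, t) = 0 := by
    intro t ht x hx
    by_contra h
    exact hx (hsupp t ht h)
  have hzi : ∀ t ∈ Set.Icc (0 : ℝ) T, ∀ i, ∀ x ∉ K, ui i (x, t) = 0 := by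
    intro t ht i x hx
    have h := cs_fderiv_zero hK (hz t ht) hx
    rw [(cs_x (hd (x, t))).fderiv] at h
    have := congrArg (fun f => f (EuclideanSpace.single i 1)) h
    simpa [hui, he] using this
  have hzt : ∀ t ∈ Set.Ioo (0 : ℝ) T, ∀ x ∉ K, ut (x, t) = 0 := by
    intro t ht x hx
    have h1 : (fun s => U (x, s)) =ᶠ[nhds t] fun _ => 0 := by
      filter_upwards [Ioo_mem_nhds ht.1 ht.2] with s hs
      exact hz s ⟨hs.1.le, hs.2.le⟩ x hx
    have h2 := h1.deriv_eq
    rw [(cs_t (hd (x, t))).deriv] at h2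
    simpa [hut] using h2
  have hzL : ∀ t ∈ Set.Icc (0 : ℝ) T, ∀ x ∉ K, L (x, t) = 0 := by
    intro t ht x hx
    rw [hL]
    refine Finset.sum_eq_zero fun i _ => ?_
    have h := cs_fderiv_zero hK (hzi t ht i) hx
    rw [(cs_x ((huiC i).differentiable (by norm_num) (x, t))).fderiv] at h
    have := congrArg (fun f => f (EuclideanSpace.single i 1)) h
    simpa [he] using this
  have hset : ∀ f : EuclideanSpace ℝ (Fin n) → ℝ, (∀ x ∉ K, f x = 0) →
      ∫ x in Ω, f x = ∫ x in K, f x := by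
    intro f hf
    rw [setIntegral_eq_integral_of_forall_compl_eq_zero hf,
      setIntegral_eq_integral_of_forall_compl_eq_zero fun x hx => hf x fun h => hx (hKΩ h)]
  have hgrad : ∀ x t, ‖gradient (fun y => U (y, t)) x‖ ^ 2 = ∑ i, ui i (x, t) ^ 2 := by
    intro x t
    rw [cs_grad]
    refine Finset.sum_congr rfl fun i _ => ?_
    rw [(cs_x (hd (x, t))).fderiv, hui, he]
    simp
  have hlap : ∀ x t, lap (fun y => U (y, t)) x = L (x, t) := by
    intro x t
    rw [cs_lap hu, hL, hui, he]
  have hder : ∀ x t, deriv (fun s => U (x, s)) t = ut (x, t) := by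
    intro x t
    rw [(cs_t (hd (x, t))).deriv, hut]
  simp only [hgrad, hlap, hder]
  -- slices
  have sl : ∀ {g : EuclideanSpace ℝ (Fin n) × ℝ → ℝ} (t : ℝ), Continuous g →
      Continuous fun x => g (x, t) := fun t hg => hg.comp (by fun_prop)
  have slC : ∀ {g : EuclideanSpace ℝ (Fin n) × ℝ → ℝ} (t : ℝ), ContDiff ℝ 1 g →
      ContDiff ℝ 1 fun x => g (x, t) := fun t hg => hg.comp (by fun_prop)
  have slF : ∀ {g : EuclideanSpace ℝ (Fin n) × ℝ → ℝ} (t : ℝ) (x) (i), ContDiff ℝ 1 g →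
      fderiv ℝ (fun x => g (x, t)) x (EuclideanSpace.single i 1) = fderiv ℝ g (x, t) (e i) := by
    intro g t x i hg
    rw [(cs_x (hg.differentiable (by norm_num) (x, t))).fderiv, he]
    simp
  have hU1 : ContDiff ℝ 1 U := hu.of_le (by norm_num)
  -- integration by parts
  have ibp1 : ∀ t ∈ Set.Ioo (0 : ℝ) T,
      ∫ x in K, fderiv ℝ (fun p => ∑ i, ui i p ^ 2) (x, t) (0, 1)
        = - (2 * ∫ x in K, L (x, t) * ut (x, t)) := by
    intro t ht
    have hI : t ∈ Set.Icc (0 : ℝ) T := ⟨ht.1.le, ht.2.le⟩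
    have h1 : ∀ x, fderiv ℝ (fun p => ∑ i, ui i p ^ 2) (x, t) (0, 1)
        = ∑ i, 2 * (ui i (x, t) * fderiv ℝ ut (x, t) (e i)) := by
      intro x
      have hdi : ∀ i, HasDerivAt (fun s => ui i (x, s)) (fderiv ℝ ut (x, t) (e i)) t := by
        intro i
        rw [← hsymm]
        exact cs_t ((huiC i).differentiable (by norm_num) (x, t))
      have hds : DifferentiableAt ℝ (fun p => ∑ i, ui i p ^ 2) (x, t) :=
        (ContDiff.sum fun i _ => (huiC i).pow 2).differentiable (by norm_num : (1 : WithTop ℕ∞) ≠ 0) (x, t)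
      have a1 := cs_t hds
      have a2 : HasDerivAt (fun s => ∑ i, ui i (x, s) ^ 2)
          (∑ i, 2 * (ui i (x, t) * fderiv ℝ ut (x, t) (e i))) t := by
        refine HasDerivAt.fun_sum fun i _ => ?_
        refine ((hdi i).fun_pow 2).congr_deriv ?_
        simp; ring
      exact a1.unique a2
    simp only [h1]
    rw [MeasureTheory.integral_finsetSum _ fun i _ => ?_]
    · have h2 : ∀ i, ∫ x in K, 2 * (ui i (x, t) * fderiv ℝ ut (x, t) (e i))
          = - (2 * ∫ x in K, fderiv ℝ (ui i) (x, t) (e i) * ut (x, t)) := by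
        intro i
        have := cs_ibp (slC t (huiC i)) (slC t hutC) hK (hzi t hI i) (EuclideanSpace.single i 1)
        simp only [slF t _ i hutC, slF t _ i (huiC i)] at this
        rw [MeasureTheory.integral_const_mul, this]; ring
      simp only [h2]
      rw [Finset.sum_neg_distrib, ← Finset.mul_sum, hL]
      simp only [Finset.sum_mul]
      rw [MeasureTheory.integral_finsetSum _ fun i _ => ?_]
      exact cs_int ((sl t (huiiC i (e i))).mul (sl t hutc)) hK
    · have : Continuous (fun p => fderiv ℝ ut p (e i)) :=
        (hutC.continuous_fderiv (by norm_num)).clm_apply continuous_const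
      exact cs_int (continuous_const.mul ((sl t (huic i)).mul (sl t this))) hK
  have ibp2 : ∀ t ∈ Set.Ioo (0 : ℝ) T,
      ∫ x in K, ∑ i, ui i (x, t) ^ 2 = - ∫ x in K, U (x, t) * L (x, t) := by
    intro t ht
    have hI : t ∈ Set.Icc (0 : ℝ) T := ⟨ht.1.le, ht.2.le⟩
    rw [hL]
    simp only [Finset.mul_sum]
    have hA : ∀ i, Integrable (fun x => ui i (x, t) ^ 2) (volume.restrict K) :=
      fun i => cs_int ((sl t (huic i)).pow 2) hK
    have hB : ∀ i, Integrable (fun x => U (x, t) * fderiv ℝ (ui i) (x, t) (e i))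
        (volume.restrict K) := fun i => cs_int ((sl t hUc).mul (sl t (huiiC i (e i)))) hK
    rw [MeasureTheory.integral_finsetSum _ fun i _ => hA i, MeasureTheory.integral_finsetSum _ fun i _ => hB i,
      ← Finset.sum_neg_distrib]
    refine Finset.sum_congr rfl fun i _ => ?_
    have := cs_ibp (slC t hU1) (slC t (huiC i)) hK (hz t hI) (EuclideanSpace.single i 1)
    simp only [slF t _ i hU1, slF t _ i (huiC i)] at this
    rw [this, neg_neg]
    refine integral_congr_ae (Filter.Eventually.of_forall fun x => ?_)
    simp only [hui]; ring
  have hDC : ContDiff ℝ 1 (fun p => ∑ i, ui i p ^ 2) :=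
    ContDiff.sum fun i _ => (huiC i).pow 2
  have hJC : ContDiff ℝ 1 (fun p => U p ^ 2) := hU1.pow 2
  have hJ' : ∀ t, ∫ x in K, fderiv ℝ (fun p => U p ^ 2) (x, t) (0, 1)
      = 2 * ∫ x in K, U (x, t) * ut (x, t) := by
    intro t
    rw [← MeasureTheory.integral_const_mul]
    refine integral_congr_ae (Filter.Eventually.of_forall fun x => ?_)
    have a1 := cs_t (hJC.differentiable (by norm_num) (x, t))
    have a2 := (cs_t (hd (x, t))).fun_pow 2
    have := a1.unique a2
    simp only [this, hut]; simp; ring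
  refine ⟨fun t => ∫ x in K, U (x, t) ^ 2, fun t => ∫ x in K, ∑ i, ui i (x, t) ^ 2,
    fun t => ∫ x in K, (ut (x, t) + L (x, t)) ^ 2,
    fun t => ∫ x in K, fderiv ℝ (fun p => U p ^ 2) (x, t) (0, 1),
    fun t => ∫ x in K, fderiv ℝ (fun p => ∑ i, ui i p ^ 2) (x, t) (0, 1),
    cs_cont hJC.continuous hK, cs_cont hDC.continuous hK,
    cs_cont ((hutc.add hLC).pow 2) hK,
    fun t => integral_nonneg fun x => by positivity,
    fun t => integral_nonneg fun x => Finset.sum_nonneg fun i _ => by positivity,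
    fun t ht => hset _ fun x hx => by simp [hz t ht x hx],
    fun t ht => hset _ fun x hx => by simp [hzi t ht _ x hx], ?_,
    fun t ht => hset _ fun x hx => by
      simp [hzt t ht x hx, hzL t ⟨ht.1.le, ht.2.le⟩ x hx],
    fun t => cs_deriv hJC hK t, fun t => cs_deriv hDC hK t, ?_, ?_⟩
  · by_cases hT : T < 0
    · exact Or.inr hT
    · left
      have hI : T ∈ Set.Icc (0 : ℝ) T := ⟨not_lt.1 hT, le_rfl⟩
      rw [hset _ fun x hx => by simp [hz T hI x hx, hzi T hI _ x hx]]
      exact integral_add (cs_int (sl T hDC.continuous) hK) (cs_int (sl T hJC.continuous) hK)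
  · intro t ht b
    simp only
    rw [ibp1 t ht, ibp2 t ht, hJ' t]
    have := cs_energy (sl t hUc) (sl t hutc) (sl t hLC) hK b
    linarith
  · intro t ht m hm
    simp only
    rw [ibp2 t ht, hJ' t]
    have := cs_energy2 (sl t hUc) (sl t hutc) (sl t hLC) hK m hm
    linarith

/-- `n`-dimensional Carleman estimate for the operator `∂ₜ + Δ` on `Ω × (0,T)`, for
functions whose spatial support is contained in a compact subset `K` of `Ω`. -/
theorem stmt1 {n : ℕ} (T c : ℝ) (hT : 0 < T) (hc : 1 + Real.sqrt (1 + 2 * T) ≤ c)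
    (Ω : Set (EuclideanSpace ℝ (Fin n))) (hΩo : IsOpen Ω) (hΩb : Bornology.IsBounded Ω) :
    ∃ lam0 C1 : ℝ, 1 ≤ lam0 ∧ 0 < C1 ∧
      ∀ lam : ℝ, lam0 ≤ lam →
        ∀ K : Set (EuclideanSpace ℝ (Fin n)), IsCompact K → K ⊆ Ω →
          ∀ u : EuclideanSpace ℝ (Fin n) → ℝ → ℝ,
            ContDiff ℝ 2 (fun p : EuclideanSpace ℝ (Fin n) × ℝ => u p.1 p.2) →
            (∀ t ∈ Set.Icc (0 : ℝ) T, Function.support (fun x => u x t) ⊆ K) →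
            C1 * Real.sqrt lam *
                (∫ t in (0 : ℝ)..T, ∫ x in Ω,
                  ‖gradient (fun y => u y t) x‖ ^ 2 * (carlemanWeight T c lam t) ^ 2)
              + C1 * lam ^ 2 * c ^ lam *
                (∫ t in (0 : ℝ)..T, ∫ x in Ω,
                  (u x t) ^ 2 * (carlemanWeight T c lam t) ^ 2)
              - C1 * Real.exp (2 * c ^ lam) *
                (∫ x in Ω, (‖gradient (fun y => u y T) x‖ ^ 2 + (u x T) ^ 2))
              - C1 * lam * (T + c) ^ lam * Real.exp (2 * (T + c) ^ lam) *
                (∫ x in Ω, (u x 0) ^ 2)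
            ≤ ∫ t in (0 : ℝ)..T, ∫ x in Ω,
                (deriv (fun s => u x s) t + lap (fun y => u y t) x) ^ 2
                  * (carlemanWeight T c lam t) ^ 2 := by
  have hc2 : 2 ≤ c := by
    have : 1 ≤ Real.sqrt (1 + 2 * T) := Real.one_le_sqrt.2 (by linarith)
    linarith
  obtain ⟨lam0, M, hl0, hM, hw⟩ := cw_weight T c hT hc2
  refine ⟨lam0, 1 / (M + 1 / 2), hl0, by positivity, ?_⟩
  intro lam hlam K hK hKΩ u hu hsupp
  obtain ⟨W, b, b', hWb, hWT, hbT, hW0⟩ := hw lam hlam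
  obtain ⟨J, D, F, J', D', hJc, hDc, hFc, hJ0, hD0, hJ, hD, hDT, hF, hJd, hDd, h1, h2⟩ :=
    cs_main hK hKΩ u hu hsupp
  have hDT := hDT.resolve_right (not_lt.2 hT.le)
  have hlam1 : 1 ≤ lam := hl0.trans hlam
  obtain ⟨Φ, hΦ⟩ : ∃ Φ : ℝ → ℝ, Φ = fun t => Real.exp (2 * (T - t + c) ^ lam) := ⟨_, rfl⟩
  have hcw : ∀ t, (carlemanWeight T c lam t) ^ 2 = Φ t := by
    intro t
    rw [carlemanWeight, hΦ, ← Real.exp_nat_mul]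
    norm_num
  have hΦp : ∀ t, 0 < Φ t := fun t => by rw [hΦ]; exact Real.exp_pos _
  have hΦd : ∀ t ∈ Set.Icc (0 : ℝ) T,
      HasDerivAt Φ (-2 * (lam * (T - t + c) ^ (lam - 1)) * Φ t) t := by
    intro t ht
    have hs : T - t + c ≠ 0 := by have := ht.2; linarith
    have d0 : HasDerivAt (fun t => T - t) (-1) t := by
      simpa using (hasDerivAt_id t).const_sub T
    have d1 := ((((d0.add_const c).rpow_const (p := lam) (Or.inl hs)).const_mul 2).exp)
    rw [hΦ]
    refine d1.congr_deriv ?_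
    ring
  have hΦc : Continuous Φ := by
    rw [hΦ]
    exact Real.continuous_exp.comp (continuous_const.mul
      (((continuous_const.sub continuous_id).add continuous_const).rpow_const
        fun x => Or.inr (by linarith)))
  simp only [hcw, MeasureTheory.integral_mul_const]
  have I1 : (∫ t in (0 : ℝ)..T, (∫ x in Ω, ‖gradient (fun y => u y t) x‖ ^ 2) * Φ t)
      = ∫ t in (0 : ℝ)..T, D t * Φ t := by
    refine intervalIntegral.integral_congr fun t ht => ?_
    rw [Set.uIcc_of_le hT.le] at ht
    simp only [hD t ht]
  have I2 : (∫ t in (0 : ℝ)..T, (∫ x in Ω, (u x t) ^ 2) * Φ t)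
      = ∫ t in (0 : ℝ)..T, J t * Φ t := by
    refine intervalIntegral.integral_congr fun t ht => ?_
    rw [Set.uIcc_of_le hT.le] at ht
    simp only [hJ t ht]
  have I3 : (∫ t in (0 : ℝ)..T,
      (∫ x in Ω, (deriv (fun s => u x s) t + lap (fun y => u y t) x) ^ 2) * Φ t)
      = ∫ t in (0 : ℝ)..T, F t * Φ t := by
    rw [intervalIntegral.integral_of_le hT.le, intervalIntegral.integral_of_le hT.le,
      MeasureTheory.integral_Ioc_eq_integral_Ioo, MeasureTheory.integral_Ioc_eq_integral_Ioo]
    refine MeasureTheory.setIntegral_congr_fun measurableSet_Ioo fun t ht => ?_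
    simp only [hF t ht]
  have hFn : ∀ t ∈ Set.Ioo (0 : ℝ) T, 0 ≤ F t := fun t ht => by
    rw [← hF t ht]
    exact MeasureTheory.integral_nonneg fun x => sq_nonneg _
  rw [I1, I2, I3, hDT, hJ 0 ⟨le_rfl, hT.le⟩]
  have key := intervalIntegral.sub_le_integral_of_hasDeriv_right_of_le
    (g := fun t => W t * (- D t + b t * J t) - Real.sqrt lam / 2 * (Φ t * J t))
    (g' := fun t => (-2 * b t * W t) * (- D t + b t * J t)
      + W t * (- D' t + (b' t * J t + b t * J' t))
      - Real.sqrt lam / 2 * ((-2 * (lam * (T - t + c) ^ (lam - 1)) * Φ t) * J t + Φ t * J' t))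
    (φ := fun t => (M + 1 / 2) * (F t * Φ t) - Real.sqrt lam * (D t * Φ t)
      - lam ^ 2 * c ^ lam * (J t * Φ t)) hT.le ?_ ?_ ?_ ?_
  · have j1 : IntervalIntegrable (fun t => (M + 1 / 2) * (F t * Φ t)) volume 0 T :=
      (continuous_const.mul (hFc.mul hΦc)).intervalIntegrable _ _
    have j2 : IntervalIntegrable (fun t => Real.sqrt lam * (D t * Φ t)) volume 0 T :=
      (continuous_const.mul (hDc.mul hΦc)).intervalIntegrable _ _
    have j3 : IntervalIntegrable (fun t => lam ^ 2 * c ^ lam * (J t * Φ t)) volume 0 T :=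
      (continuous_const.mul (hJc.mul hΦc)).intervalIntegrable _ _
    rw [intervalIntegral.integral_sub (j1.sub j2) j3, intervalIntegral.integral_sub j1 j2,
      intervalIntegral.integral_const_mul, intervalIntegral.integral_const_mul,
      intervalIntegral.integral_const_mul] at key
    have hΦT : Φ T = Real.exp (2 * c ^ lam) := by rw [hΦ]; simp
    have hE := Real.exp_pos (2 * c ^ lam)
    have b1 : 0 ≤ (b T - Real.sqrt lam / 2) * J T * Real.exp (2 * c ^ lam) :=
      mul_nonneg (mul_nonneg (by linarith) (hJ0 T)) hE.le
    have b1' : 0 ≤ Real.exp (2 * c ^ lam) * J T := mul_nonneg hE.le (hJ0 T)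
    have b2 := mul_le_mul_of_nonneg_right hW0 (hJ0 0)
    have b3 : 0 ≤ W 0 * D 0 := mul_nonneg (hWb 0 ⟨le_rfl, hT.le⟩).2.2.1 (hD0 0)
    have b4 : 0 ≤ Real.sqrt lam / 2 * (Φ 0 * J 0) :=
      mul_nonneg (by positivity) (mul_nonneg (hΦp 0).le (hJ0 0))
    rw [hWT, hΦT] at key
    have fin : Real.sqrt lam * (∫ t in (0 : ℝ)..T, D t * Φ t)
        + lam ^ 2 * c ^ lam * (∫ t in (0 : ℝ)..T, J t * Φ t)
        - Real.exp (2 * c ^ lam) * (D T + J T)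
        - lam * (T + c) ^ lam * Real.exp (2 * (T + c) ^ lam) * J 0
        ≤ (M + 1 / 2) * ∫ t in (0 : ℝ)..T, F t * Φ t := by linarith
    have hMp : 0 < M + 1 / 2 := by positivity
    have fin2 := mul_le_mul_of_nonneg_left fin (one_div_pos.2 hMp).le
    rw [← mul_assoc (1 / (M + 1 / 2)) (M + 1 / 2), one_div_mul_cancel hMp.ne', one_mul] at fin2
    refine le_trans (le_of_eq ?_) fin2
    ring
  · intro t ht
    have w := hWb t ht
    exact (((w.1.continuousAt.mul (hDc.neg.continuousAt.add
      (w.2.1.continuousAt.mul hJc.continuousAt))).sub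
      (continuousAt_const.mul (hΦc.continuousAt.mul hJc.continuousAt)))).continuousWithinAt
  · intro t ht
    have hI : t ∈ Set.Icc (0 : ℝ) T := ⟨ht.1.le, ht.2.le⟩
    have w := hWb t hI
    exact ((w.1.mul ((hDd t).neg.add (w.2.1.mul (hJd t)))).sub
      (((hΦd t hI).mul (hJd t)).const_mul (Real.sqrt lam / 2))).hasDerivWithinAt
  · refine ContinuousOn.integrableOn_Icc (Continuous.continuousOn ?_)
    exact ((continuous_const.mul (hFc.mul hΦc)).sub (continuous_const.mul (hDc.mul hΦc))).sub
      (continuous_const.mul (hJc.mul hΦc))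
  · intro t ht
    obtain ⟨-, -, w1, w2, w3⟩ := hWb t ⟨ht.1.le, ht.2.le⟩
    have hΦt : Real.exp (2 * (T - t + c) ^ lam) = Φ t := by rw [hΦ]
    rw [hΦt] at w2 w3
    have sp : 0 < Real.sqrt lam := Real.sqrt_pos.2 (by linarith)
    have e1 := mul_le_mul_of_nonneg_left (h1 t ht (b t)) w1
    have e2 := mul_le_mul_of_nonneg_right w2 (hFn t ht)
    have e3 := mul_le_mul_of_nonneg_left (h2 t ht _ sp) (hΦp t).le
    rw [Real.sq_sqrt (by linarith : (0 : ℝ) ≤ lam)] at e3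
    have e4 := mul_le_mul_of_nonneg_right w3 (hJ0 t)
    linarith
end

section
/- Let T > 0, let c ≥ 1 + √(1 + 2T), let Ω ⊂ ℝⁿ be a bounded open set, let K ⊂ Ω be a compact set, and let g : ℝⁿ × [0,T] → ℝ be of class C¹ with |g| and its first derivatives bounded by a constant G. There exist a number λ₀ ≥ 1 and a constant C₂ > 0 (depending only on c, T, G, Ω) such that for every λ ≥ λ₀ and every pair of functions u, v : ℝⁿ × [0,T] → ℝ of class C² with supp u(·,t) ⊆ K and supp v(·,t) ⊆ K for every t ∈ [0,T], one has ∫₀ᵀ∫_Ω (∂ₜu − Δu + g Δv)² φ_λ² dx dt ≥ λ c^{λ−1} ∫₀ᵀ∫_Ω |∇u|² φ_λ² dx dt + (λ²/4) c^{2λ−2} ∫₀ᵀ∫_Ω u² φ_λ² dx dt − C₂ λ (T+c)^λ ∫₀ᵀ∫_Ω |∇v|² φ_λ² dx dt − C₂ λ (T+c)^λ e^{2(T+c)^λ} ∫_Ω u²(x,0) dx. -/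
open MeasureTheory intervalIntegral

abbrev EE (n : ℕ) := EuclideanSpace ℝ (Fin n)

noncomputable abbrev ee {n : ℕ} (i : Fin n) : EuclideanSpace ℝ (Fin n) := EuclideanSpace.single i 1

lemma cw_fderiv_x {n : ℕ} {F : EE n × ℝ → ℝ} {x : EE n} {t : ℝ}
    (hF : DifferentiableAt ℝ F (x, t)) (e : EE n) :
    fderiv ℝ (fun y => F (y, t)) x e = fderiv ℝ F (x, t) (e, 0) := by
  have h : HasFDerivAt (fun y : EE n => (y, t)) (ContinuousLinearMap.inl ℝ (EE n) ℝ) x :=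
    hasFDerivAt_prodMk_left x t
  have := (hF.hasFDerivAt.comp x h).fderiv
  change fderiv ℝ (F ∘ fun y => (y, t)) x e = _
  rw [this]; simp

lemma cw_hasDeriv_t {n : ℕ} {F : EE n × ℝ → ℝ} {x : EE n} {t : ℝ}
    (hF : DifferentiableAt ℝ F (x, t)) :
    HasDerivAt (fun s => F (x, s)) (fderiv ℝ F (x, t) (0, 1)) t := by
  have h : HasFDerivAt (fun s : ℝ => (x, s)) (ContinuousLinearMap.inr ℝ (EE n) ℝ) t :=
    hasFDerivAt_prodMk_right x t
  have := (hF.hasFDerivAt.comp t h).hasDerivAt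
  simp only [ContinuousLinearMap.comp_apply, ContinuousLinearMap.inr_apply] at this
  exact this

lemma cw_grad_coord {n : ℕ} (f : EE n → ℝ) (x : EE n) :
    ‖gradient f x‖ ^ 2 = ∑ i, (fderiv ℝ f x (ee i)) ^ 2 := by
  rw [EuclideanSpace.norm_sq_eq]
  refine Finset.sum_congr rfl fun i _ => ?_
  have : gradient f x i = fderiv ℝ f x (ee i) := by
    have h := InnerProductSpace.toDual_symm_apply (𝕜 := ℝ) (x := ee i) (y := fderiv ℝ f x)
    rw [← h, gradient, ee, EuclideanSpace.inner_single_right]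
    simp
  rw [this]; simp

lemma cw_lap {n : ℕ} {f : EE n → ℝ} (hf : ContDiff ℝ 2 f) (x : EE n) :
    lap f x = ∑ i, fderiv ℝ (fun y => fderiv ℝ f y (ee i)) x (ee i) := by
  unfold lap
  refine Finset.sum_congr rfl fun i _ => ?_
  rw [iteratedFDeriv_two_apply]
  have hd : DifferentiableAt ℝ (fderiv ℝ f) x :=
    ((hf.fderiv_right (m := 1) (by norm_num)).differentiable (by norm_num)) x
  rw [fderiv_clm_apply hd (differentiableAt_const _)]
  simp

lemma cw_lap_joint {n : ℕ} {F : EE n × ℝ → ℝ} (hF : ContDiff ℝ 2 F) (x : EE n) (t : ℝ) :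
    lap (fun y => F (y, t)) x
      = ∑ i, fderiv ℝ (fun p => fderiv ℝ F p (ee i, 0)) (x, t) (ee i, 0) := by
  have h1 : ContDiff ℝ 2 (fun y => F (y, t)) := hF.comp (by fun_prop)
  rw [cw_lap h1]
  refine Finset.sum_congr rfl fun i _ => ?_
  have h2 : (fun y => fderiv ℝ (fun y => F (y, t)) y (ee i))
      = fun y => (fun p => fderiv ℝ F p (ee i, 0)) (y, t) := by
    funext y
    exact cw_fderiv_x (hF.differentiable (by norm_num) _) _
  rw [h2, cw_fderiv_x (F := fun p => fderiv ℝ F p (ee i, 0))]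
  have : ContDiff ℝ 1 (fun p => fderiv ℝ F p (ee i, 0)) :=
    (hF.fderiv_right (m := 1) (by norm_num)).clm_apply contDiff_const
  exact this.differentiable (by norm_num) _

lemma cw_lap_cont {n : ℕ} {F : EE n × ℝ → ℝ} (hF : ContDiff ℝ 2 F) :
    Continuous (fun p : EE n × ℝ => lap (fun y => F (y, p.2)) p.1) := by
  have : (fun p : EE n × ℝ => lap (fun y => F (y, p.2)) p.1)
      = fun p => ∑ i, fderiv ℝ (fun p => fderiv ℝ F p (ee i, 0)) p (ee i, 0) := by
    funext p; exact cw_lap_joint hF p.1 p.2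
  rw [this]
  refine continuous_finsetSum _ fun i _ => ?_
  have : ContDiff ℝ 1 (fun p => fderiv ℝ F p (ee i, 0)) :=
    (hF.fderiv_right (m := 1) (by norm_num)).clm_apply contDiff_const
  exact (this.continuous_fderiv (by norm_num)).clm_apply continuous_const

lemma cw_grad_cont {n : ℕ} {F : EE n × ℝ → ℝ} (hF : ContDiff ℝ 2 F) :
    Continuous (fun p : EE n × ℝ => ‖gradient (fun y => F (y, p.2)) p.1‖ ^ 2) := by
  have : (fun p : EE n × ℝ => ‖gradient (fun y => F (y, p.2)) p.1‖ ^ 2)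
      = fun p => ∑ i, (fderiv ℝ F p (ee i, 0)) ^ 2 := by
    funext p; rw [cw_grad_coord]
    refine Finset.sum_congr rfl fun i _ => ?_
    rw [cw_fderiv_x (hF.differentiable (by norm_num) _)]
  rw [this]
  refine continuous_finsetSum _ fun i _ => ?_
  exact ((hF.continuous_fderiv (by norm_num)).clm_apply continuous_const).pow 2

lemma cw_integrable {n : ℕ} {Ω : Set (EE n)} (hΩb : Bornology.IsBounded Ω) {f : EE n → ℝ}
    (hf : Continuous f) : Integrable f (volume.restrict Ω) :=
  (hf.continuousOn.integrableOn_compact hΩb.isCompact_closure).mono_set subset_closure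

lemma cw_param_cont {n : ℕ} {Ω : Set (EE n)} (hΩb : Bornology.IsBounded Ω)
    {f : EE n → ℝ → ℝ} (hf : Continuous (fun p : EE n × ℝ => f p.1 p.2)) :
    Continuous (fun t => ∫ x in Ω, f x t) := by
  have h := continuous_parametric_integral_of_continuous (μ := (volume : Measure (EE n)).restrict Ω)
    (f := fun t x => f x t) (s := closure Ω) (hf.comp continuous_swap) hΩb.isCompact_closure
  have e : ((volume : Measure (EE n)).restrict Ω).restrict (closure Ω) = volume.restrict Ω := by
    rw [Measure.restrict_restrict isClosed_closure.measurableSet,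
      Set.inter_eq_right.2 subset_closure]
  rw [e] at h
  exact h

lemma cw_param_deriv {n : ℕ} {Ω : Set (EE n)} (hΩo : IsOpen Ω) (hΩb : Bornology.IsBounded Ω)
    {f f' : EE n → ℝ → ℝ} (hf : Continuous (fun p : EE n × ℝ => f p.1 p.2))
    (hf' : Continuous (fun p : EE n × ℝ => f' p.1 p.2))
    (hd : ∀ x t, HasDerivAt (f x) (f' x t) t) (t : ℝ) :
    HasDerivAt (fun t => ∫ x in Ω, f x t) (∫ x in Ω, f' x t) t := by
  obtain ⟨M, hM⟩ := ((hΩb.isCompact_closure.prod (isCompact_Icc (a := t - 1) (b := t + 1)))).exists_bound_of_continuousOn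
    hf'.continuousOn
  have hs : ∀ s, Continuous (fun x => f x s) := fun s => hf.comp (by fun_prop : Continuous fun x : EE n => (x, s))
  have hs' : ∀ s, Continuous (fun x => f' x s) := fun s => hf'.comp (by fun_prop : Continuous fun x : EE n => (x, s))
  refine (_root_.hasDerivAt_integral_of_dominated_loc_of_deriv_le (F := fun t x => f x t)
    (F' := fun t x => f' x t) (bound := fun _ => M) (s := Set.Icc (t-1) (t+1)) (Icc_mem_nhds (by linarith) (by linarith))
    (Filter.Eventually.of_forall fun s => (hs s).aestronglyMeasurable) (cw_integrable hΩb (hs t))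
    (hs' t).aestronglyMeasurable ?_ (cw_integrable hΩb continuous_const) ?_).2
  · rw [ae_restrict_iff' hΩo.measurableSet]
    refine Filter.Eventually.of_forall fun x hx s hs => hM (x, s) ⟨subset_closure hx, hs⟩
  · exact Filter.Eventually.of_forall fun x s _ => hd x s

lemma cw_ibp {n : ℕ} {Ω K : Set (EE n)} (hK : IsCompact K)
    (hKΩ : K ⊆ Ω) {a b : EE n → ℝ} (ha : ContDiff ℝ 1 a) (hb : ContDiff ℝ 2 b)
    (hs : Function.support a ⊆ K) :
    ∫ x in Ω, a x * lap b x = - ∫ x in Ω, ∑ i, fderiv ℝ a x (ee i) * fderiv ℝ b x (ee i) := by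
  have hac : HasCompactSupport a := HasCompactSupport.intro hK fun x hx => by
    by_contra h; exact hx (hs h)
  have hts : tsupport a ⊆ K := closure_minimal hs hK.isClosed
  have ha0 : ∀ x, x ∉ Ω → a x = 0 := fun x hx => by
    by_contra h; exact hx (hKΩ (hs h))
  have hda0 : ∀ x, x ∉ Ω → fderiv ℝ a x = 0 := fun x hx => by
    by_contra h
    exact hx (hKΩ (hts (support_fderiv_subset ℝ (f := a) h)))
  rw [setIntegral_eq_integral_of_forall_compl_eq_zero (fun x hx => by simp [ha0 x hx]),
    setIntegral_eq_integral_of_forall_compl_eq_zero (fun x hx => by simp [hda0 x hx])]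
  have hbi : ∀ i : Fin n, ContDiff ℝ 1 (fun y => fderiv ℝ b y (ee i)) := fun i =>
    (hb.fderiv_right (m := 1) (by norm_num)).clm_apply contDiff_const
  have hdac : ∀ i : Fin n, Continuous fun x => fderiv ℝ a x (ee i) := fun i =>
    (ha.continuous_fderiv (by norm_num)).clm_apply continuous_const
  have hdas : ∀ i : Fin n, HasCompactSupport fun x => fderiv ℝ a x (ee i) := fun i =>
    hac.fderiv_apply (𝕜 := ℝ) (ee i)
  have hbic : ∀ i : Fin n, Continuous fun x => fderiv ℝ (fun y => fderiv ℝ b y (ee i)) x (ee i) := fun i =>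
    ((hbi i).continuous_fderiv (by norm_num)).clm_apply continuous_const
  have I1 : ∀ i : Fin n, Integrable (fun x => fderiv ℝ a x (ee i) * fderiv ℝ b x (ee i)) := fun i =>
    ((hdac i).mul (hbi i).continuous).integrable_of_hasCompactSupport ((hdas i).mul_right)
  have I2 : ∀ i : Fin n, Integrable (fun x => a x * fderiv ℝ (fun y => fderiv ℝ b y (ee i)) x (ee i)) := fun i =>
    (ha.continuous.mul (hbic i)).integrable_of_hasCompactSupport (hac.mul_right)
  have I3 : ∀ i : Fin n, Integrable (fun x => a x * fderiv ℝ b x (ee i)) := fun i =>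
    (ha.continuous.mul (hbi i).continuous).integrable_of_hasCompactSupport (hac.mul_right)
  simp_rw [cw_lap hb, Finset.mul_sum]
  rw [integral_finsetSum _ fun i _ => I2 i, integral_finsetSum _ fun i _ => I1 i,
    ← Finset.sum_neg_distrib]
  refine Finset.sum_congr rfl fun i _ => ?_
  exact integral_mul_fderiv_eq_neg_fderiv_mul_of_integrable (I1 i) (I2 i) (I3 i)
    (fun x _ => ha.differentiable (by norm_num) x) (fun x _ => (hbi i).differentiable (by norm_num) x)

lemma cw_lap_cont1 {n : ℕ} {f : EE n → ℝ} (hf : ContDiff ℝ 2 f) : Continuous (lap f) := by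
  have e : lap f = fun x => ∑ i, fderiv ℝ (fun y => fderiv ℝ f y (ee i)) x (ee i) := by
    funext x; exact cw_lap hf x
  rw [e]
  refine continuous_finsetSum _ fun i _ => ?_
  have : ContDiff ℝ 1 (fun y => fderiv ℝ f y (ee i)) :=
    (hf.fderiv_right (m := 1) (by norm_num)).clm_apply contDiff_const
  exact (this.continuous_fderiv (by norm_num)).clm_apply continuous_const

lemma cw_grad_cont1 {n : ℕ} {f : EE n → ℝ} (hf : ContDiff ℝ 2 f) :
    Continuous (fun x => ‖gradient f x‖ ^ 2) := by
  simp_rw [cw_grad_coord]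
  refine continuous_finsetSum _ fun i _ => ?_
  exact ((hf.continuous_fderiv (by norm_num)).clm_apply continuous_const).pow 2

lemma cw_grad_le {n : ℕ} {G : ℝ} {f : EE n → ℝ} {x : EE n} (h : ‖fderiv ℝ f x‖ ≤ G) :
    ∑ i, (fderiv ℝ f x (ee i)) ^ 2 ≤ G ^ 2 := by
  rw [← cw_grad_coord]
  have : ‖gradient f x‖ = ‖fderiv ℝ f x‖ := by
    rw [gradient]; exact LinearIsometryEquiv.norm_map _ _
  rw [this]
  exact pow_le_pow_left₀ (norm_nonneg _) h 2

lemma cw_point {n : ℕ} {G : ℝ} {a b h : EE n → ℝ} {x : EE n}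
    (ha : DifferentiableAt ℝ a x) (hh : DifferentiableAt ℝ h x)
    (hg : |h x| ≤ G) (hg' : ‖fderiv ℝ h x‖ ≤ G) :
    2 * ∑ i, fderiv ℝ (fun y => a y * h y) x (ee i) * fderiv ℝ b x (ee i)
      ≤ ‖gradient a x‖ ^ 2 + (a x) ^ 2 + 2 * G ^ 2 * ‖gradient b x‖ ^ 2 := by
  have e : ∑ i, fderiv ℝ (fun y => a y * h y) x (ee i) * fderiv ℝ b x (ee i)
      = (∑ i, h x * (fderiv ℝ a x (ee i) * fderiv ℝ b x (ee i)))
        + a x * ∑ i, fderiv ℝ h x (ee i) * fderiv ℝ b x (ee i) := by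
    rw [Finset.mul_sum, ← Finset.sum_add_distrib]
    refine Finset.sum_congr rfl fun i _ => ?_
    rw [fderiv_fun_mul ha hh]
    simp; ring
  have hG2 : (h x) ^ 2 ≤ G ^ 2 := sq_le_sq' (abs_le.1 hg).1 (abs_le.1 hg).2
  have h1 : 2 * ∑ i, h x * (fderiv ℝ a x (ee i) * fderiv ℝ b x (ee i))
      ≤ ‖gradient a x‖ ^ 2 + G ^ 2 * ‖gradient b x‖ ^ 2 := by
    rw [cw_grad_coord, cw_grad_coord, Finset.mul_sum, Finset.mul_sum, ← Finset.sum_add_distrib]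
    refine Finset.sum_le_sum fun i _ => ?_
    nlinarith [sq_nonneg (fderiv ℝ a x (ee i) - h x * fderiv ℝ b x (ee i)),
      mul_le_mul_of_nonneg_right hG2 (sq_nonneg (fderiv ℝ b x (ee i)))]
  have h2 : (∑ i, fderiv ℝ h x (ee i) * fderiv ℝ b x (ee i)) ^ 2 ≤ G ^ 2 * ‖gradient b x‖ ^ 2 := by
    refine (Finset.sum_mul_sq_le_sq_mul_sq _ _ _).trans ?_
    rw [← cw_grad_coord b]
    exact mul_le_mul_of_nonneg_right (cw_grad_le hg') (sq_nonneg _)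
  rw [e]
  nlinarith [sq_nonneg (a x - ∑ i, fderiv ℝ h x (ee i) * fderiv ℝ b x (ee i))]

lemma cw_space {n : ℕ} {Ω K : Set (EE n)} (hΩb : Bornology.IsBounded Ω)
    (hK : IsCompact K) (hKΩ : K ⊆ Ω) {G q : ℝ} (hq : 0 ≤ q) {a b h w : EE n → ℝ}
    (ha : ContDiff ℝ 2 a) (hb : ContDiff ℝ 2 b) (hh : ContDiff ℝ 1 h) (hw : Continuous w)
    (hs : Function.support a ⊆ K) (hg : ∀ x, |h x| ≤ G) (hg' : ∀ x, ‖fderiv ℝ h x‖ ≤ G) :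
    q * (∫ x in Ω, 2 * a x * w x) + q * (∫ x in Ω, ‖gradient a x‖ ^ 2)
      - (q ^ 2 + q) * (∫ x in Ω, (a x) ^ 2) - 2 * G ^ 2 * q * (∫ x in Ω, ‖gradient b x‖ ^ 2)
      ≤ ∫ x in Ω, (w x - lap a x + h x * lap b x) ^ 2 := by
  have ha1 : ContDiff ℝ 1 a := ha.of_le (by norm_num)
  have cl_a := cw_lap_cont1 ha
  have cl_b := cw_lap_cont1 hb
  have ca := ha.continuous
  have ch := hh.continuous
  have hah : ContDiff ℝ 1 (fun x => a x * h x) := ha1.mul hh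
  have e1 := cw_ibp hK hKΩ ha1 ha hs
  have e2 := cw_ibp hK hKΩ hah hb (fun x hx => hs (fun h0 => hx (by simp [h0])))
  have e1' : ∫ x in Ω, a x * lap a x = - ∫ x in Ω, ‖gradient a x‖ ^ 2 := by
    rw [e1]; congr 2; funext x; rw [cw_grad_coord]
    exact Finset.sum_congr rfl fun i _ => by ring
  have hc1 : ∀ f : EE n → ℝ, ContDiff ℝ 1 f → ∀ i, Continuous fun x => fderiv ℝ f x (ee i) :=
    fun f hf i => (hf.continuous_fderiv (by norm_num)).clm_apply continuous_const
  have e3 : 2 * ∫ x in Ω, ∑ i, fderiv ℝ (fun y => a y * h y) x (ee i) * fderiv ℝ b x (ee i)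
      ≤ (∫ x in Ω, ‖gradient a x‖ ^ 2) + (∫ x in Ω, (a x) ^ 2)
        + 2 * G ^ 2 * ∫ x in Ω, ‖gradient b x‖ ^ 2 := by
    have Ia := cw_integrable hΩb (cw_grad_cont1 ha)
    have Ib := cw_integrable hΩb (cw_grad_cont1 hb)
    have Iaa := cw_integrable hΩb (by fun_prop : Continuous fun x => (a x) ^ 2)
    rw [← MeasureTheory.integral_const_mul, ← MeasureTheory.integral_const_mul, ← MeasureTheory.integral_add Ia Iaa,
      ← MeasureTheory.integral_add (Ia.fun_add Iaa) (Ib.const_mul _)]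
    refine integral_mono ?_ ((Ia.fun_add Iaa).fun_add (Ib.const_mul _)) fun x => ?_
    · refine (cw_integrable hΩb ?_).const_mul _
      exact continuous_finsetSum _ fun i _ => (hc1 _ hah i).mul (hc1 _ (hb.of_le (by norm_num)) i)
    · exact cw_point (ha1.differentiable (by norm_num) x) (hh.differentiable (by norm_num) x)
        (hg x) (hg' x)
  have e4 : q * (∫ x in Ω, 2 * a x * w x) + (-2 * q) * (∫ x in Ω, a x * lap a x)
      + 2 * q * (∫ x in Ω, a x * h x * lap b x) + (- q ^ 2) * (∫ x in Ω, (a x) ^ 2)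
      ≤ ∫ x in Ω, (w x - lap a x + h x * lap b x) ^ 2 := by
    have J1 := (cw_integrable hΩb (by fun_prop : Continuous fun x => 2 * a x * w x)).const_mul q
    have J2 := (cw_integrable hΩb (by fun_prop : Continuous fun x => a x * lap a x)).const_mul (-2 * q)
    have J3 := (cw_integrable hΩb (by fun_prop : Continuous fun x => a x * h x * lap b x)).const_mul (2 * q)
    have J4 := (cw_integrable hΩb (by fun_prop : Continuous fun x => (a x) ^ 2)).const_mul (- q ^ 2)
    rw [← MeasureTheory.integral_const_mul, ← MeasureTheory.integral_const_mul, ← MeasureTheory.integral_const_mul, ← MeasureTheory.integral_const_mul,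
      ← MeasureTheory.integral_add J1 J2, ← MeasureTheory.integral_add (J1.fun_add J2) J3, ← MeasureTheory.integral_add ((J1.fun_add J2).fun_add J3) J4]
    refine integral_mono (((J1.fun_add J2).fun_add J3).fun_add J4) (cw_integrable hΩb (by fun_prop)) fun x => ?_
    nlinarith [sq_nonneg ((w x - lap a x + h x * lap b x) - q * a x)]
  rw [e1', e2] at e4
  nlinarith [mul_le_mul_of_nonneg_left e3 hq]

lemma cw_time {T c G lam : ℝ} (hT : 0 < T) (hc : 2 ≤ c) (hl : 2 ≤ lam)
    {U D A V PP : ℝ → ℝ} (hU : Continuous U) (hD : Continuous D) (hA : Continuous A)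
    (hV : Continuous V) (hP : Continuous PP)
    (U0 : ∀ t, 0 ≤ U t) (A0 : ∀ t, 0 ≤ A t) (V0 : ∀ t, 0 ≤ V t)
    (hUD : ∀ t, HasDerivAt U (D t) t)
    (hest : ∀ t ∈ Set.Icc 0 T, ∀ q : ℝ, 0 ≤ q →
      q * D t + q * A t - (q ^ 2 + q) * U t - 2 * G ^ 2 * q * V t ≤ PP t) :
    lam * c ^ (lam - 1) * (∫ t in (0 : ℝ)..T, A t * (carlemanWeight T c lam t) ^ 2)
      + lam ^ 2 / 4 * c ^ (2 * lam - 2) * (∫ t in (0 : ℝ)..T, U t * (carlemanWeight T c lam t) ^ 2)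
      - (2 * G ^ 2 + 1) * lam * (T + c) ^ lam *
        (∫ t in (0 : ℝ)..T, V t * (carlemanWeight T c lam t) ^ 2)
      - (2 * G ^ 2 + 1) * lam * (T + c) ^ lam * Real.exp (2 * (T + c) ^ lam) * U 0
    ≤ ∫ t in (0 : ℝ)..T, PP t * (carlemanWeight T c lam t) ^ 2 := by
  set W : ℝ → ℝ := fun t => (carlemanWeight T c lam t) ^ 2 with hW
  set q : ℝ → ℝ := fun t => lam * (T - t + c) ^ (lam - 1) with hqdef
  set q' : ℝ → ℝ := fun t => - (lam * (lam - 1) * (T - t + c) ^ (lam - 2)) with hq'def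
  have hspos : ∀ t ∈ Set.Icc 0 T, 2 ≤ T - t + c := fun t ht => by linarith [ht.2]
  have hsd : ∀ t : ℝ, HasDerivAt (fun t => T - t + c) (-1) t := fun t => by
    simpa using ((hasDerivAt_id t).const_sub T).add_const c
  have hqd : ∀ t ∈ Set.Icc 0 T, HasDerivAt q (q' t) t := fun t ht => by
    have h := ((hsd t).rpow_const (p := lam - 1) (Or.inl (by linarith [hspos t ht]))).const_mul lam
    refine h.congr_deriv (Eq.symm ?_)
    change -(lam * (lam - 1) * (T - t + c) ^ (lam - 2)) = _
    rw [show lam - 1 - 1 = lam - 2 by ring]; ring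
  have hWd : ∀ t ∈ Set.Icc 0 T, HasDerivAt W (-2 * q t * W t) t := fun t ht => by
    have h := (((hsd t).rpow_const (p := lam) (Or.inl (by linarith [hspos t ht]))).exp).pow 2
    refine h.congr_deriv (Eq.symm ?_)
    change -2 * (lam * (T - t + c) ^ (lam - 1)) * (Real.exp ((T - t + c) ^ lam)) ^ 2 = _
    push_cast; ring
  have hqc : ContinuousOn q (Set.Icc 0 T) := fun t ht => (hqd t ht).continuousAt.continuousWithinAt
  have hWc : ContinuousOn W (Set.Icc 0 T) := fun t ht => (hWd t ht).continuousAt.continuousWithinAt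
  have hq'c : ContinuousOn q' (Set.Icc 0 T) := by
    refine (continuousOn_const.mul (ContinuousOn.rpow_const (by fun_prop) fun t ht => Or.inl ?_)).neg
    linarith [hspos t ht]
  set F' : ℝ → ℝ := fun t => (q' t * W t + q t * (-2 * q t * W t)) * U t + q t * W t * D t with hF'
  have hFd : ∀ t ∈ Set.Icc 0 T, HasDerivAt (fun t => q t * W t * U t) (F' t) t := fun t ht =>
    ((hqd t ht).mul (hWd t ht)).mul (hUD t)
  have hF'c : ContinuousOn F' (Set.Icc 0 T) := by
    have := hU.continuousOn (s := Set.Icc 0 T)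
    have := hD.continuousOn (s := Set.Icc 0 T)
    simp only [hF']; fun_prop
  have II : ∀ f : ℝ → ℝ, ContinuousOn f (Set.Icc 0 T) → IntervalIntegrable f volume 0 T :=
    fun f hf => hf.intervalIntegrable_of_Icc hT.le
  have hF : ∫ t in (0 : ℝ)..T, F' t = q T * W T * U T - q 0 * W 0 * U 0 := by
    refine integral_eq_sub_of_hasDerivAt (f := fun t => q t * W t * U t) (fun t ht => hFd t ?_) (II _ hF'c)
    rwa [Set.uIcc_of_le hT.le] at ht
  set k1 := lam * c ^ (lam - 1)
  set k2 := lam ^ 2 / 4 * c ^ (2 * lam - 2)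
  set k3 := (2 * G ^ 2 + 1) * lam * (T + c) ^ lam
  have hk2 : k2 = k1 ^ 2 / 4 := by
    simp only [k1, k2]
    rw [show 2 * lam - 2 = (lam - 1) * (2 : ℕ) by push_cast; ring, Real.rpow_mul (by linarith),
      Real.rpow_natCast]
    ring
  have hk1 : 2 ≤ k1 := by
    have : 1 ≤ c ^ (lam - 1) := Real.one_le_rpow (by linarith) (by linarith)
    simp only [k1]; nlinarith
  have hqk : ∀ t ∈ Set.Icc 0 T, k1 ≤ q t := fun t ht => by
    refine mul_le_mul_of_nonneg_left ?_ (by linarith)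
    exact Real.rpow_le_rpow (by linarith) (by linarith [ht.2]) (by linarith)
  have hqk3 : ∀ t ∈ Set.Icc 0 T, q t ≤ lam * (T + c) ^ lam := fun t ht => by
    refine mul_le_mul_of_nonneg_left ?_ (by linarith)
    refine (Real.rpow_le_rpow (by linarith [hspos t ht]) (by linarith [ht.1] : T - t + c ≤ T + c) (by linarith)).trans ?_
    exact Real.rpow_le_rpow_of_exponent_le (by linarith) (by linarith)
  have hq'0 : ∀ t ∈ Set.Icc 0 T, q' t ≤ 0 := fun t ht => by
    have : 0 ≤ (T - t + c) ^ (lam - 2) := Real.rpow_nonneg (by linarith [hspos t ht]) _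
    simp only [hq'def]
    have := mul_nonneg (mul_nonneg (by linarith : 0 ≤ lam) (by linarith : 0 ≤ lam - 1)) this
    linarith
  have hW0 : ∀ t, 0 ≤ W t := fun t => sq_nonneg _
  have hpt : ∀ t ∈ Set.Icc 0 T,
      F' t + k1 * (A t * W t) + k2 * (U t * W t) - k3 * (V t * W t) ≤ PP t * W t := fun t ht => by
    have a1 := hqk t ht
    have a2 := hqk3 t ht
    have a3 := hq'0 t ht
    have h := mul_le_mul_of_nonneg_right (hest t ht (q t) (by linarith)) (hW0 t)
    have b1 : 0 ≤ (q t - k1) * (A t * W t) :=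
      mul_nonneg (by linarith) (mul_nonneg (A0 t) (hW0 t))
    have b2 : 0 ≤ (q t ^ 2 - q t - q' t - k2) * (U t * W t) := by
      refine mul_nonneg ?_ (mul_nonneg (U0 t) (hW0 t))
      rw [hk2]; nlinarith
    have b3 : 0 ≤ (k3 - 2 * G ^ 2 * q t) * (V t * W t) := by
      refine mul_nonneg ?_ (mul_nonneg (V0 t) (hW0 t))
      have := mul_le_mul_of_nonneg_left a2 (by positivity : 0 ≤ 2 * G ^ 2)
      simp only [k3]; nlinarith
    simp only [hF']
    nlinarith
  have hbd : q 0 * W 0 * U 0 ≤ k3 * Real.exp (2 * (T + c) ^ lam) * U 0 := by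
    refine mul_le_mul_of_nonneg_right ?_ (U0 0)
    have hW00 : W 0 = Real.exp (2 * (T + c) ^ lam) := by
      simp only [hW, carlemanWeight]
      rw [← Real.exp_nat_mul]; simp
    rw [hW00]
    refine mul_le_mul_of_nonneg_right ?_ (Real.exp_pos _).le
    have h0 : (0 : ℝ) ∈ Set.Icc 0 T := ⟨le_rfl, hT.le⟩
    have := hqk3 0 h0
    have h1 := hqk 0 h0
    simp only [k3]
    nlinarith [mul_nonneg (sq_nonneg G) (by linarith : 0 ≤ lam * (T + c) ^ lam)]
  have hTd : 0 ≤ q T * W T * U T :=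
    mul_nonneg (mul_nonneg (by linarith [hqk T ⟨hT.le, le_rfl⟩]) (hW0 T)) (U0 T)
  have hm := integral_mono_on hT.le
    ((((II F' hF'c).add ((II _ (hA.continuousOn.mul hWc)).const_mul k1)).add
      ((II _ (hU.continuousOn.mul hWc)).const_mul k2)).sub ((II _ (hV.continuousOn.mul hWc)).const_mul k3))
    (II _ (hP.continuousOn.mul hWc)) hpt
  rw [intervalIntegral.integral_sub (((II F' hF'c).add ((II _ (hA.continuousOn.mul hWc)).const_mul k1)).add
      ((II _ (hU.continuousOn.mul hWc)).const_mul k2)) ((II _ (hV.continuousOn.mul hWc)).const_mul k3),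
    intervalIntegral.integral_add ((II F' hF'c).add ((II _ (hA.continuousOn.mul hWc)).const_mul k1))
      ((II _ (hU.continuousOn.mul hWc)).const_mul k2),
    intervalIntegral.integral_add (II F' hF'c) ((II _ (hA.continuousOn.mul hWc)).const_mul k1),
    hF, intervalIntegral.integral_const_mul, intervalIntegral.integral_const_mul,
    intervalIntegral.integral_const_mul] at hm
  simp only [Pi.mul_apply, hW] at hm hbd hTd
  linarith

/-- `n`-dimensional quasi-Carleman estimate for the operator `∂ₜ − Δu + g Δv` on
`Ω × (0,T)`, for pairs of functions whose spatial supports are contained in a compact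
subset `K` of `Ω`; `g` is `C¹` with `|g|` and its first derivatives bounded by `G`. -/
theorem stmt3 {n : ℕ} (T c G : ℝ) (hT : 0 < T) (hc : 1 + Real.sqrt (1 + 2 * T) ≤ c)
    (hG : 0 < G)
    (Ω : Set (EuclideanSpace ℝ (Fin n))) (hΩo : IsOpen Ω) (hΩb : Bornology.IsBounded Ω) :
    ∃ lam0 C2 : ℝ, 1 ≤ lam0 ∧ 0 < C2 ∧
      ∀ g : EuclideanSpace ℝ (Fin n) → ℝ → ℝ,
        ContDiff ℝ 1 (fun p : EuclideanSpace ℝ (Fin n) × ℝ => g p.1 p.2) →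
        (∀ x, ∀ t ∈ Set.Icc (0 : ℝ) T,
          |g x t| ≤ G ∧
          ‖fderiv ℝ (fun p : EuclideanSpace ℝ (Fin n) × ℝ => g p.1 p.2) (x, t)‖ ≤ G) →
        ∀ lam : ℝ, lam0 ≤ lam →
          ∀ K : Set (EuclideanSpace ℝ (Fin n)), IsCompact K → K ⊆ Ω →
            ∀ u v : EuclideanSpace ℝ (Fin n) → ℝ → ℝ,
              ContDiff ℝ 2 (fun p : EuclideanSpace ℝ (Fin n) × ℝ => u p.1 p.2) →
              ContDiff ℝ 2 (fun p : EuclideanSpace ℝ (Fin n) × ℝ => v p.1 p.2) →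
              (∀ t ∈ Set.Icc (0 : ℝ) T,
                Function.support (fun x => u x t) ⊆ K ∧
                Function.support (fun x => v x t) ⊆ K) →
              lam * c ^ (lam - 1) *
                  (∫ t in (0 : ℝ)..T, ∫ x in Ω,
                    ‖gradient (fun y => u y t) x‖ ^ 2 * (carlemanWeight T c lam t) ^ 2)
                + lam ^ 2 / 4 * c ^ (2 * lam - 2) *
                  (∫ t in (0 : ℝ)..T, ∫ x in Ω,
                    (u x t) ^ 2 * (carlemanWeight T c lam t) ^ 2)
                - C2 * lam * (T + c) ^ lam *
                  (∫ t in (0 : ℝ)..T, ∫ x in Ω,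
                    ‖gradient (fun y => v y t) x‖ ^ 2 * (carlemanWeight T c lam t) ^ 2)
                - C2 * lam * (T + c) ^ lam * Real.exp (2 * (T + c) ^ lam) *
                  (∫ x in Ω, (u x 0) ^ 2)
              ≤ ∫ t in (0 : ℝ)..T, ∫ x in Ω,
                  (deriv (fun s => u x s) t - lap (fun y => u y t) x
                      + g x t * lap (fun y => v y t) x) ^ 2
                    * (carlemanWeight T c lam t) ^ 2 := by

  have hc2 : 2 ≤ c := by
    have : 1 ≤ Real.sqrt (1 + 2 * T) := Real.one_le_sqrt.2 (by linarith)
    linarith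
  refine ⟨2, 2 * G ^ 2 + 1, by norm_num, by positivity, ?_⟩
  intro g hg hgG lam hlam K hK hKΩ u v hu hv hsupp
  have hu1 : ∀ p, DifferentiableAt ℝ (fun p : EE n × ℝ => u p.1 p.2) p :=
    fun p => hu.differentiable (by norm_num) p
  have hdt : ∀ x t, HasDerivAt (fun s => u x s)
      (fderiv ℝ (fun p : EE n × ℝ => u p.1 p.2) (x, t) (0, 1)) t :=
    fun x t => cw_hasDeriv_t (F := fun p : EE n × ℝ => u p.1 p.2) (hu1 (x, t))
  have hdt' : ∀ x t, HasDerivAt (fun s => u x s) (deriv (fun s => u x s) t) t :=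
    fun x t => (hdt x t).differentiableAt.hasDerivAt
  have cut : Continuous (fun p : EE n × ℝ => deriv (fun s => u p.1 s) p.2) := by
    have : (fun p : EE n × ℝ => deriv (fun s => u p.1 s) p.2)
        = fun p => fderiv ℝ (fun p : EE n × ℝ => u p.1 p.2) p (0, 1) := by
      funext p; exact (hdt p.1 p.2).deriv
    rw [this]
    exact (hu.continuous_fderiv (by norm_num)).clm_apply continuous_const
  have cu := hu.continuous
  have cg := hg.continuous
  have clu : Continuous (fun p : EE n × ℝ => lap (fun y => u y p.2) p.1) := by
    have h := cw_lap_cont hu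
    dsimp only at h
    exact h
  have clv : Continuous (fun p : EE n × ℝ => lap (fun y => v y p.2) p.1) := by
    have h := cw_lap_cont hv
    dsimp only at h
    exact h
  have cgu : Continuous (fun p : EE n × ℝ => ‖gradient (fun y => u y p.2) p.1‖ ^ 2) :=
    by
    have h := cw_grad_cont hu
    dsimp only at h
    exact h
  have cgv : Continuous (fun p : EE n × ℝ => ‖gradient (fun y => v y p.2) p.1‖ ^ 2) :=
    by
    have h := cw_grad_cont hv
    dsimp only at h
    exact h
  have sl : ∀ t : ℝ, ContDiff ℝ 2 (fun x : EE n => (x, t)) := fun t => by fun_prop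
  have key := cw_time (T := T) (c := c) (G := G) (lam := lam) hT hc2 hlam
    (U := fun t => ∫ x in Ω, (u x t) ^ 2)
    (D := fun t => ∫ x in Ω, 2 * u x t * deriv (fun s => u x s) t)
    (A := fun t => ∫ x in Ω, ‖gradient (fun y => u y t) x‖ ^ 2)
    (V := fun t => ∫ x in Ω, ‖gradient (fun y => v y t) x‖ ^ 2)
    (PP := fun t => ∫ x in Ω, (deriv (fun s => u x s) t - lap (fun y => u y t) x
                      + g x t * lap (fun y => v y t) x) ^ 2)
    (cw_param_cont hΩb (cu.pow 2))
    (cw_param_cont hΩb ((continuous_const.mul cu).mul cut))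
    (cw_param_cont hΩb cgu) (cw_param_cont hΩb cgv)
    (cw_param_cont hΩb (((cut.sub clu).add (cg.mul clv)).pow 2))
    (fun t => integral_nonneg fun x => sq_nonneg _)
    (fun t => integral_nonneg fun x => sq_nonneg _)
    (fun t => integral_nonneg fun x => sq_nonneg _)
    (fun t => cw_param_deriv hΩo hΩb (f := fun x t => (u x t) ^ 2)
      (f' := fun x t => 2 * u x t * deriv (fun s => u x s) t) (cu.pow 2)
      ((continuous_const.mul cu).mul cut) (fun x t => by
        have := (hdt' x t).pow 2
        refine this.congr_deriv ?_
        push_cast; ring) t)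
    (fun t ht q hq => by
      refine cw_space hΩb hK hKΩ hq (a := fun x => u x t) (b := fun x => v x t)
        (h := fun x => g x t) (w := fun x => deriv (fun s => u x s) t)
        (hu.comp (sl t)) (hv.comp (sl t)) (hg.comp ((sl t).of_le (by norm_num)))
        (cut.comp (sl t).continuous) (hsupp t ht).1 (fun x => (hgG x t ht).1) (fun x => ?_)
      have hgd : DifferentiableAt ℝ (fun p : EE n × ℝ => g p.1 p.2) (x, t) :=
        hg.differentiable (by norm_num) _
      refine ContinuousLinearMap.opNorm_le_bound _ hG.le fun e => ?_
      rw [cw_fderiv_x (F := fun p : EE n × ℝ => g p.1 p.2) hgd]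
      refine (ContinuousLinearMap.le_of_opNorm_le _ (hgG x t ht).2 _).trans ?_
      simp [Prod.norm_def])
  simp only [MeasureTheory.integral_mul_const]
  exact key
end
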